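/- arXiv:1304.7965 — 2 statements merged into one kernel-verified Lean document; each statement's English description precedes it below -/
import Mathlib

section
/- Let n, m, d be positive integers and let g_1, …, g_m be convex polynomials on ℝ^n, each of degree at most d. Let S := {x ∈ ℝ^n : g_i(x) ≤ 0 for all i = 1, …, m} and let x̄ ∈ S. Set τ := max{2/κ(n, 2d), 1/(β(n−1)·d^n)} = 1/min{((2d−1)^n + 1)/2, β(n−1)·d^n}. Then there exist constants c > 0 and ε > 0 such that for all x ∈ ℝ^n with ‖x − x̄‖ ≤ ε, dist(x, S) ≤ c·( max_{1 ≤ i ≤ m} [g_i(x)]_+ )^τ. -/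
open Metric Set Filter
open scoped BigOperators
noncomputable section

theorem Polynomial.abs_eval_one_le_of_abs_eval_le {d : ℕ} (hd : 0 < d) {p : Polynomial ℝ}
    (hp : p.natDegree ≤ d) {t M : ℝ} (ht : 0 < t) (ht1 : t ≤ 1)
    (hM : ∀ s ∈ Icc 0 t, |p.eval s| ≤ M) :
    |p.eval 1| ≤ (d + 1) * ((d / t) ^ d * M) := by
  have hd' : (0 : ℝ) < d := by exact_mod_cast hd
  let v : ℕ → ℝ := fun i => t * i / d
  have hv : Set.InjOn v (Finset.range (d + 1) : Set ℕ) := by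
    intro i _ j _ hij
    have : t * (i : ℝ) / d = t * j / d := hij
    field_simp at this
    exact_mod_cast this
  have hM0 : 0 ≤ M := (abs_nonneg _).trans (hM 0 ⟨le_rfl, ht.le⟩)
  have hdeg : p.degree < (Finset.range (d + 1)).card := by
    rw [Finset.card_range]
    exact lt_of_le_of_lt Polynomial.degree_le_natDegree (by exact_mod_cast Nat.lt_succ_of_le hp)
  have hnode : ∀ i ∈ Finset.range (d + 1), v i ∈ Icc 0 t := by
    intro i hi
    have hi' : (i : ℝ) ≤ d := by exact_mod_cast Nat.lt_succ_iff.mp (Finset.mem_range.mp hi)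
    refine ⟨by positivity, ?_⟩
    change t * i / d ≤ t
    rw [div_le_iff₀ hd']
    gcongr
  have hbasis : ∀ i ∈ Finset.range (d + 1),
      |(Lagrange.basis (Finset.range (d + 1)) v i).eval 1| ≤ (d / t) ^ d := by
    intro i hi
    rw [Lagrange.basis, Polynomial.eval_prod, Finset.abs_prod]
    have hcard : ((Finset.range (d + 1)).erase i).card = d := by
      rw [Finset.card_erase_of_mem hi, Finset.card_range, Nat.add_sub_cancel]
    calc _ ≤ ∏ _j ∈ (Finset.range (d + 1)).erase i, ((d : ℝ) / t) := by
          refine Finset.prod_le_prod (fun _ _ => abs_nonneg _) fun j hj => ?_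
          obtain ⟨hji, hj⟩ := Finset.mem_erase.mp hj
          have hvj := hnode j hj
          have hsub : v i - v j = t / d * ((i : ℝ) - j) := by simp only [v]; ring
          have hone : (1 : ℝ) ≤ |(i : ℝ) - j| := by
            have : (1 : ℤ) ≤ |(i : ℤ) - j| := Int.one_le_abs (by omega)
            exact_mod_cast this
          have hnum : |1 - v j| ≤ 1 := by
            rw [abs_le]; constructor <;> linarith [hvj.1, hvj.2]
          rw [Lagrange.basisDivisor, Polynomial.eval_mul, Polynomial.eval_C, Polynomial.eval_sub,
            Polynomial.eval_X, Polynomial.eval_C, abs_mul, abs_inv, hsub, abs_mul,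
            abs_of_pos (by positivity : 0 < t / d)]
          calc (t / d * |(i : ℝ) - j|)⁻¹ * |1 - v j| ≤ (t / d * 1)⁻¹ * 1 := by gcongr
            _ = d / t := by field_simp
      _ = _ := by rw [Finset.prod_const, hcard]
  rw [Lagrange.eq_interpolate hv hdeg, Lagrange.interpolate_apply, Polynomial.eval_finsetSum]
  refine (Finset.abs_sum_le_sum_abs _ _).trans ?_
  calc _ ≤ ∑ _i ∈ Finset.range (d + 1), ((d : ℝ) / t) ^ d * M := by
        refine Finset.sum_le_sum fun i hi => ?_
        rw [Polynomial.eval_mul, Polynomial.eval_C, abs_mul, mul_comm]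
        exact mul_le_mul (hbasis i hi) (hM _ (hnode i hi)) (abs_nonneg _) (by positivity)
    _ = _ := by simp

theorem exists_weights_of_forall_not_neg {E ι : Type*} [AddCommGroup E] [Module ℝ E] [Fintype ι]
    {g : ι → E → ℝ} (hg : ∀ i, ConvexOn ℝ univ (g i)) (hno : ¬ ∃ z, ∀ i, g i z < 0) :
    ∃ w : ι → ℝ, (∀ i, 0 ≤ w i) ∧ (∃ i, 0 < w i) ∧ ∀ x, 0 ≤ ∑ i, w i * g i x := by
  classical
  let C : Set (ι → ℝ) := ⋃ x, Set.pi univ fun i => Ioi (g i x)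
  have hmem : ∀ u, u ∈ C ↔ ∃ x, ∀ i, g i x < u i := by intro u; simp [C]
  have hC : Convex ℝ C := by
    intro u hu u' hu' a b ha hb hab
    obtain ⟨x, hx⟩ := (hmem u).1 hu
    obtain ⟨x', hx'⟩ := (hmem u').1 hu'
    refine (hmem _).2 ⟨a • x + b • x', fun i => ?_⟩
    refine ((hg i).2 (mem_univ x) (mem_univ x') ha hb hab).trans_lt ?_
    simp only [smul_eq_mul, Pi.add_apply, Pi.smul_apply]
    rcases ha.eq_or_lt with rfl | ha
    · have : b = 1 := by linarith
      subst this
      simpa using hx' i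
    · have h1 := mul_lt_mul_of_pos_left (hx i) ha
      have h2 := mul_le_mul_of_nonneg_left (hx' i).le hb
      linarith
  have hCo : IsOpen C :=
    isOpen_iUnion fun x => isOpen_set_pi finite_univ fun i _ => isOpen_Ioi
  have h0 : (0 : ι → ℝ) ∉ C := fun h => hno ((hmem 0).1 h)
  obtain ⟨f, hf⟩ := geometric_hahn_banach_open_point hC hCo h0
  have hfsum : ∀ u, f u = ∑ i, u i * f (Pi.single i 1) := by
    intro u
    conv_lhs => rw [← Finset.univ_sum_single u]
    rw [map_sum]
    refine Finset.sum_congr rfl fun i _ => ?_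
    have : (Pi.single i (u i) : ι → ℝ) = u i • Pi.single i 1 := by
      rw [← Pi.single_smul, smul_eq_mul, mul_one]
    simp [this]
  have hfneg : ∀ x, ∀ u : ι → ℝ, (∀ i, 0 < u i) → f (fun i => g i x + u i) < 0 := by
    intro x u hu
    have := hf _ ((hmem _).2 ⟨x, fun i => lt_add_of_pos_right (g i x) (hu i)⟩)
    simpa using this
  have hlin : ∀ x, f (fun i => g i x) ≤ 0 := by
    intro x
    have hlim : Tendsto (fun s : ℝ => f (fun i => g i x + s)) (nhdsWithin 0 (Ioi 0))
        (nhds (f (fun i => g i x + 0))) := by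
      refine Tendsto.mono_left (Continuous.tendsto ?_ 0) nhdsWithin_le_nhds
      fun_prop
    simp only [add_zero] at hlim
    exact le_of_tendsto hlim (by
      filter_upwards [self_mem_nhdsWithin] with s hs
      exact (hfneg x (fun _ => s) fun _ => hs).le)
  have hcone : ∀ i, f (Pi.single i 1) ≤ 0 := by
    intro i
    by_contra! hi
    obtain ⟨N, hN⟩ := exists_nat_gt ((- f (fun j => g j 0 + 1)) / f (Pi.single i 1))
    rw [div_lt_iff₀ hi] at hN
    have h1 := hfneg 0 (fun j => 1 + (N : ℝ) * (Pi.single i 1 : ι → ℝ) j) (by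
      intro j
      have : 0 ≤ (Pi.single i 1 : ι → ℝ) j := by
        by_cases h : j = i
        · subst h; simp
        · simp [h]
      positivity)
    have h2 : (fun j => g j 0 + (1 + (N : ℝ) * (Pi.single i 1 : ι → ℝ) j))
        = (fun j => g j 0 + 1) + (N : ℝ) • (Pi.single i 1 : ι → ℝ) := by
      ext j; simp [add_assoc]
    rw [h2, map_add, map_smul, smul_eq_mul] at h1
    linarith
  refine ⟨fun i => - f (Pi.single i 1), fun i => by linarith [hcone i], ?_, fun x => ?_⟩
  · by_contra! hall
    have hz : ∀ i, f (Pi.single i 1) = 0 := fun i =>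
      le_antisymm (hcone i) (by linarith [hall i])
    have := hfneg 0 (fun _ => 1) fun _ => one_pos
    rw [hfsum] at this
    simp [hz] at this
  · have h1 := hlin x
    rw [hfsum] at h1
    have h2 : ∑ i, -f (Pi.single i 1) * g i x = - ∑ i, g i x * f (Pi.single i 1) := by
      rw [← Finset.sum_neg_distrib]
      exact Finset.sum_congr rfl fun i _ => by ring
    rw [h2]
    linarith

/-- Restricted to every line through the origin, `g` is a polynomial of degree at most `d`. -/
def IsPolynomialOnLines {E : Type*} [AddCommGroup E] [Module ℝ E] (d : ℕ) (g : E → ℝ) : Prop :=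
  ∀ v, ∃ p : Polynomial ℝ, p.natDegree ≤ d ∧ ∀ t : ℝ, g (t • v) = p.eval t

/-- Restricted to every ray from the origin, `g` is a polynomial of degree at most `d`. -/
def IsPolynomialOnRays {E : Type*} [AddCommGroup E] [Module ℝ E] (d : ℕ) (g : E → ℝ) : Prop :=
  ∀ v, ∃ p : Polynomial ℝ, p.natDegree ≤ d ∧ ∀ t : ℝ, 0 ≤ t → g (t • v) = p.eval t

theorem IsPolynomialOnLines.isPolynomialOnRays {E : Type*} [AddCommGroup E] [Module ℝ E] {d : ℕ}
    {g : E → ℝ} (hg : IsPolynomialOnLines d g) : IsPolynomialOnRays d g := fun v =>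
  (hg v).imp fun _ hp => ⟨hp.1, fun t _ => hp.2 t⟩

theorem IsPolynomialOnLines.sum_mul {E ι : Type*} [AddCommGroup E] [Module ℝ E] [Fintype ι] {d : ℕ}
    {g : ι → E → ℝ} (hg : ∀ i, IsPolynomialOnLines d (g i)) (w : ι → ℝ) :
    IsPolynomialOnLines d fun x => ∑ i, w i * g i x := by
  intro v
  choose p hp hpe using fun i => hg i v
  refine ⟨∑ i, Polynomial.C (w i) * p i, ?_, fun t => ?_⟩
  · exact Polynomial.natDegree_sum_le_of_forall_le _ _ fun i _ =>
      (Polynomial.natDegree_C_mul_le _ _).trans (hp i)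
  · simp [Polynomial.eval_finsetSum, hpe]

theorem ConvexOn.apply_smul_le {E : Type*} [AddCommGroup E] [Module ℝ E] {h : E → ℝ}
    (hh : ConvexOn ℝ univ h) (h0 : h 0 = 0) {t : ℝ} (ht : t ∈ Icc (0 : ℝ) 1) (x : E) :
    h (t • x) ≤ t * h x := by
  have := hh.2 (mem_univ x) (mem_univ 0) ht.1 (sub_nonneg.2 ht.2) (by ring)
  simpa [h0] using this

theorem IsPolynomialOnRays.apply_smul_eq_zero {E : Type*} [AddCommGroup E] [Module ℝ E] {d : ℕ}
    {h : E → ℝ} (hp : IsPolynomialOnRays d h) (hh : ConvexOn ℝ univ h) (hnn : ∀ x, 0 ≤ h x)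
    (h0 : h 0 = 0) {v : E} (hv : h v = 0) {t : ℝ} (ht : 0 ≤ t) : h (t • v) = 0 := by
  obtain ⟨p, -, hpe⟩ := hp v
  have hp0 : p = 0 := by
    refine Polynomial.eq_zero_of_infinite_isRoot p
      ((Icc_infinite (zero_lt_one (α := ℝ))).mono fun s hs => ?_)
    change p.eval s = 0
    rw [← hpe s hs.1]
    refine le_antisymm ?_ (hnn _)
    simpa [hv] using hh.apply_smul_le h0 hs v
  simp [hpe t ht, hp0]

/-- The zero set of a nonnegative convex function, polynomial on rays, vanishing at the origin. -/
def zeroSubmodule {E : Type*} [AddCommGroup E] [Module ℝ E] {d : ℕ} {h : E → ℝ}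
    (hp : IsPolynomialOnRays d h) (hh : ConvexOn ℝ univ h) (hnn : ∀ x, 0 ≤ h x)
    (h0 : h 0 = 0) (hneg : ∀ v, h v = 0 → h (-v) = 0) : Submodule ℝ E where
  carrier := {v | h v = 0}
  zero_mem' := h0
  add_mem' := by
    intro u v hu hv
    refine le_antisymm ?_ (hnn _)
    have := hh.2 (mem_univ ((2 : ℝ) • u)) (mem_univ ((2 : ℝ) • v))
      (by norm_num : (0 : ℝ) ≤ 1 / 2) (by norm_num : (0 : ℝ) ≤ 1 / 2) (by norm_num)
    rw [hp.apply_smul_eq_zero hh hnn h0 hu zero_le_two,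
      hp.apply_smul_eq_zero hh hnn h0 hv zero_le_two, smul_smul, smul_smul] at this
    norm_num at this
    exact this
  smul_mem' := by
    intro a v hv
    rcases le_total 0 a with ha | ha
    · exact hp.apply_smul_eq_zero hh hnn h0 hv ha
    · have := hp.apply_smul_eq_zero hh hnn h0 (hneg v hv) (neg_nonneg.2 ha)
      rwa [neg_smul_neg] at this

/-- Near the origin, the system `g i y ≤ 0` has a Hölder error bound of exponent `α`. -/
def HolderErrorBound {E ι : Type*} [NormedAddCommGroup E] (g : ι → E → ℝ) (α : ℝ) : Prop :=
  ∃ c > 0, ∃ ε > 0, ∀ x, ‖x‖ ≤ ε → ∀ r : ℝ, 0 ≤ r → (∀ i, g i x ≤ r) →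
    ∃ y, (∀ i, g i y ≤ 0) ∧ ‖x - y‖ ≤ c * r ^ α

theorem HolderErrorBound.of_le_one {E ι : Type*} [NormedAddCommGroup E] {g : ι → E → ℝ}
    (h0 : ∀ i, g i 0 ≤ 0) {α : ℝ} (hα : 0 ≤ α)
    {c ε : ℝ} (hε : 0 < ε)
    (H : ∀ x, ‖x‖ ≤ ε → ∀ r : ℝ, 0 ≤ r → r ≤ 1 → (∀ i, g i x ≤ r) →
      ∃ y, (∀ i, g i y ≤ 0) ∧ ‖x - y‖ ≤ c * r ^ α) : HolderErrorBound g α := by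
  refine ⟨max c ε, lt_max_of_lt_right hε, ε, hε, fun x hx r hr hgr => ?_⟩
  rcases le_total r 1 with hr1 | hr1
  · obtain ⟨y, hy, hxy⟩ := H x hx r hr hr1 hgr
    refine ⟨y, hy, hxy.trans ?_⟩
    gcongr
    exact le_max_left _ _
  · refine ⟨0, h0, ?_⟩
    rw [sub_zero]
    calc ‖x‖ ≤ max c ε * 1 := by rw [mul_one]; exact hx.trans (le_max_right _ _)
      _ ≤ max c ε * r ^ α := by
        gcongr
        exact Real.one_le_rpow hr1 hα

theorem HolderErrorBound.of_slater {E ι : Type*} [NormedAddCommGroup E]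
    [NormedSpace ℝ E] [Finite ι] {g : ι → E → ℝ} (hg : ∀ i, ConvexOn ℝ univ (g i))
    (h0 : ∀ i, g i 0 ≤ 0) {z : E} (hz : ∀ i, g i z < 0 ∨ ∀ x, g i x ≤ 0) {α : ℝ} (hα : 0 ≤ α)
    (hα1 : α ≤ 1) : HolderErrorBound g α := by
  obtain ⟨δ, hδ, hzδ⟩ : ∃ δ > 0, ∀ i, g i z ≤ -δ ∨ ∀ x, g i x ≤ 0 := by
    have h1 : ∀ i, ∀ᶠ δ in nhdsWithin (0 : ℝ) (Ioi 0), g i z ≤ -δ ∨ ∀ x, g i x ≤ 0 := by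
      intro i
      rcases hz i with h | h
      · filter_upwards [nhdsWithin_le_nhds (Iio_mem_nhds (neg_pos.2 h))] with δ hδ
        left
        have : δ < - g i z := hδ
        linarith
      · exact Eventually.of_forall fun _ => Or.inr h
    obtain ⟨δ, h2, h3⟩ := ((eventually_all.2 h1).and self_mem_nhdsWithin).exists
    exact ⟨δ, h3, h2⟩
  refine HolderErrorBound.of_le_one h0 hα (c := (‖z‖ + 1) / δ) one_pos fun x hx r hr hr1 hgr => ?_
  have hrδ : 0 < r + δ := by linarith
  set s := r / (r + δ) with hs
  have hs0 : 0 ≤ s := by positivity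
  have hs1 : 0 ≤ 1 - s := by
    rw [sub_nonneg, hs, div_le_one hrδ]; linarith
  refine ⟨(1 - s) • x + s • z, fun i => ?_, ?_⟩
  · rcases hzδ i with h | h
    · refine ((hg i).2 (mem_univ x) (mem_univ z) hs1 hs0 (by ring)).trans ?_
      simp only [smul_eq_mul]
      calc (1 - s) * g i x + s * g i z ≤ (1 - s) * r + s * (-δ) := by
            gcongr
            exact hgr i
        _ = 0 := by rw [hs]; field_simp; ring
    · exact h _
  · have h1 : x - ((1 - s) • x + s • z) = s • (x - z) := by module
    rw [h1, norm_smul, Real.norm_of_nonneg hs0]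
    have h2 : s ≤ r / δ := by rw [hs]; gcongr; linarith
    have h3 : r ≤ r ^ α := by
      simpa using Real.rpow_le_rpow_of_exponent_ge' hr hr1 hα hα1
    calc s * ‖x - z‖ ≤ r / δ * (‖z‖ + 1) := by
          gcongr
          linarith [norm_sub_le x z]
      _ = (‖z‖ + 1) / δ * r := by ring
      _ ≤ _ := by gcongr

section HolderErrorBound

variable {E ι : Type*} [NormedAddCommGroup E] [InnerProductSpace ℝ E] [FiniteDimensional ℝ E]

theorem exists_mul_norm_sub_starProjection_pow_le {d : ℕ} (hd : 0 < d) {h : E → ℝ}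
    (hp : IsPolynomialOnRays d h) (hh : ConvexOn ℝ univ h) (hnn : ∀ x, 0 ≤ h x)
    (h0 : h 0 = 0) {V : Submodule ℝ E} (hV : ∀ v, v ∈ V ↔ h v = 0) :
    ∃ c > 0, ∀ x, ‖x‖ ≤ 1 → c * ‖x - V.starProjection x‖ ^ d ≤ h x := by
  have hd' : (0 : ℝ) < d := by exact_mod_cast hd
  have hcont : Continuous h := by
    simpa using hh.continuousOn isOpen_univ
  obtain ⟨c, hc, hcle⟩ : ∃ c > 0, ∀ u ∈ Vᗮ, ‖u‖ = 1 → c ≤ h u := by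
    let K : Set E := sphere 0 1 ∩ (Vᗮ : Set E)
    have hK : IsCompact K :=
      (isCompact_sphere 0 1).inter_right (Submodule.closed_of_finiteDimensional _)
    rcases K.eq_empty_or_nonempty with hKe | hKn
    · refine ⟨1, one_pos, fun u hu hu1 => ?_⟩
      have : u ∈ K := ⟨by simpa using hu1, hu⟩
      rw [hKe] at this
      exact this.elim
    · obtain ⟨u₀, hu₀, hmin⟩ := hK.exists_isMinOn hKn hcont.continuousOn
      refine ⟨h u₀, (hnn _).lt_of_ne' fun hz => ?_, fun u hu hu1 => hmin ⟨by simpa using hu1, hu⟩⟩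
      have hu0 : u₀ = 0 :=
        (Submodule.disjoint_def.1 V.orthogonal_disjoint) _ ((hV _).2 hz) hu₀.2
      have : ‖u₀‖ = 1 := by simpa using hu₀.1
      simp [hu0] at this
  refine ⟨c / ((d + 1) * (d : ℝ) ^ d * 2 ^ d), by positivity, fun x hx => ?_⟩
  set w := x - V.starProjection x with hw
  rcases eq_or_ne w 0 with hw0 | hw0
  · simp [hw0, hd.ne', hnn]
  have hwpos : 0 < ‖w‖ := norm_pos_iff.2 hw0
  have hw2 : ‖w‖ ≤ 2 := by
    have := V.norm_starProjection_apply_le x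
    linarith [norm_sub_le x (V.starProjection x)]
  have hwV : w ∈ Vᗮ := V.sub_starProjection_mem_orthogonal x
  set u := ‖w‖⁻¹ • w with hu
  have hu1 : ‖u‖ = 1 := by
    rw [hu, norm_smul, norm_inv, norm_norm, inv_mul_cancel₀ hwpos.ne']
  have hcu := hcle u (Vᗮ.smul_mem _ hwV) hu1
  set s := ‖w‖ / 2 with hs
  have hspos : 0 < s := by positivity
  have hhalf : h (s • u) ≤ h x := by
    have hPV : h (-V.starProjection x) = 0 :=
      (hV _).1 (V.neg_mem (V.starProjection_apply_mem x))
    have h1 := hh.2 (mem_univ x) (mem_univ (-V.starProjection x))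
      (by norm_num : (0 : ℝ) ≤ 1 / 2) (by norm_num : (0 : ℝ) ≤ 1 / 2) (by norm_num)
    have h2 : s • u = (1 / 2 : ℝ) • x + (1 / 2 : ℝ) • -V.starProjection x := by
      rw [← smul_add, ← sub_eq_add_neg, ← hw, hu, smul_smul, hs]
      congr 1
      field_simp
    rw [h2]
    rw [hPV] at h1
    simp only [smul_eq_mul, mul_zero, add_zero] at h1
    linarith [hnn x]
  obtain ⟨p, hpd, hpe⟩ := hp u
  have hbound : ∀ σ ∈ Icc 0 s, |p.eval σ| ≤ h (s • u) := by
    intro σ hσ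
    rw [← hpe σ hσ.1, abs_of_nonneg (hnn _)]
    have hσs : σ / s ∈ Icc (0 : ℝ) 1 := ⟨div_nonneg hσ.1 hspos.le, (div_le_one hspos).2 hσ.2⟩
    have h1 := hh.apply_smul_le h0 hσs (s • u)
    rw [smul_smul, div_mul_cancel₀ _ hspos.ne'] at h1
    exact h1.trans (mul_le_of_le_one_left (hnn _) hσs.2)
  have hmain := Polynomial.abs_eval_one_le_of_abs_eval_le hd hpd hspos (by linarith) hbound
  rw [← hpe 1 zero_le_one, one_smul, abs_of_nonneg (hnn _)] at hmain
  have h3 : c ≤ (d + 1) * ((d / s) ^ d * h x) :=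
    hcu.trans (hmain.trans (by gcongr))
  have h4 : ‖w‖ = 2 * s := by rw [hs]; ring
  rw [div_mul_eq_mul_div, div_le_iff₀ (by positivity), h4, mul_pow]
  calc c * (2 ^ d * s ^ d) ≤ (d + 1) * ((d / s) ^ d * h x) * (2 ^ d * s ^ d) := by gcongr
    _ = _ := by
      rw [div_pow]
      field_simp

theorem exists_le_add_mul_norm_sub {g : ι → E → ℝ} [Fintype ι]
    (hg : ∀ i, ConvexOn ℝ univ (g i)) :
    ∃ K ≥ 0, ∃ δ > 0, ∀ i x y, ‖x‖ ≤ δ → ‖y‖ ≤ δ → g i y ≤ g i x + K * ‖x - y‖ := by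
  choose K t ht hK using fun i => (hg i).locallyLipschitz 0
  have hT : ⋂ i, t i ∈ nhds (0 : E) := iInter_mem.2 ht
  obtain ⟨δ, hδ, hδT⟩ := Metric.nhds_basis_closedBall.mem_iff.1 hT
  refine ⟨∑ i, (K i : ℝ), Finset.sum_nonneg fun i _ => (K i).2, δ, hδ, fun i x y hx hy => ?_⟩
  have hx' := mem_iInter.1 (hδT (by simpa using hx : x ∈ closedBall 0 δ)) i
  have hy' := mem_iInter.1 (hδT (by simpa using hy : y ∈ closedBall 0 δ)) i
  have h1 := (hK i).dist_le_mul y hy' x hx'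
  rw [Real.dist_eq, dist_comm, dist_eq_norm] at h1
  have h2 : (K i : ℝ) ≤ ∑ i, (K i : ℝ) :=
    Finset.single_le_sum (f := fun i => (K i : ℝ)) (fun i _ => (K i).2) (Finset.mem_univ i)
  have h3 : (K i : ℝ) * ‖x - y‖ ≤ (∑ i, (K i : ℝ)) * ‖x - y‖ := by gcongr
  linarith [le_abs_self (g i y - g i x)]

theorem HolderErrorBound.of_submodule [Fintype ι] {g : ι → E → ℝ}
    (hg : ∀ i, ConvexOn ℝ univ (g i)) (h0 : ∀ i, g i 0 ≤ 0) {V : Submodule ℝ E} {α β : ℝ}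
    (hα : 0 < α) (hα1 : α ≤ 1) (hβ : 0 < β) (hβ1 : β ≤ 1)
    (hV : HolderErrorBound (fun i (x : V) => g i x) α) {C : ℝ} (hC : 0 < C)
    (hdist : ∀ x, ‖x‖ ≤ 1 → ∀ r : ℝ, 0 ≤ r → (∀ i, g i x ≤ r) →
      ‖x - V.starProjection x‖ ≤ C * r ^ β) :
    HolderErrorBound g (α * β) := by
  obtain ⟨c, hc, ε, hε, H⟩ := hV
  obtain ⟨K, hK, δ, hδ, hL⟩ := exists_le_add_mul_norm_sub hg
  refine HolderErrorBound.of_le_one h0 (by positivity) (c := C + c * (1 + K * C) ^ α)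
    (ε := min ε (min δ 1)) (by positivity) fun x hx r hr hr1 hgr => ?_
  have hxε : ‖x‖ ≤ ε := hx.trans (min_le_left _ _)
  have hxδ : ‖x‖ ≤ δ := hx.trans ((min_le_right _ _).trans (min_le_left _ _))
  have hx1 : ‖x‖ ≤ 1 := hx.trans ((min_le_right _ _).trans (min_le_right _ _))
  have hP := V.norm_starProjection_apply_le x
  have hd := hdist x hx1 r hr hgr
  have hrβ : r ≤ r ^ β := by
    simpa using Real.rpow_le_rpow_of_exponent_ge' hr hr1 hβ.le hβ1
  have hgP : ∀ i, g i (V.starProjection x) ≤ (1 + K * C) * r ^ β := by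
    intro i
    have h1 := hL i x _ hxδ (hP.trans hxδ)
    have h2 : K * ‖x - V.starProjection x‖ ≤ K * (C * r ^ β) := by gcongr
    linarith [hgr i]
  obtain ⟨y, hy, hxy⟩ := H ⟨V.starProjection x, V.starProjection_apply_mem x⟩ (hP.trans hxε)
    ((1 + K * C) * r ^ β) (by positivity) hgP
  refine ⟨y, hy, ?_⟩
  have hxy' : ‖V.starProjection x - y‖ ≤ c * ((1 + K * C) ^ α * r ^ (α * β)) := by
    rw [mul_comm α β, Real.rpow_mul hr, ← Real.mul_rpow (by positivity) (by positivity)]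
    exact hxy
  have hrαβ : r ^ β ≤ r ^ (α * β) :=
    Real.rpow_le_rpow_of_exponent_ge' hr hr1 (by positivity) (mul_le_of_le_one_left hβ.le hα1)
  calc ‖x - y‖ ≤ ‖x - V.starProjection x‖ + ‖V.starProjection x - y‖ :=
        norm_sub_le_norm_sub_add_norm_sub _ _ _
    _ ≤ C * r ^ (α * β) + c * ((1 + K * C) ^ α * r ^ (α * β)) := by
        refine add_le_add (hd.trans ?_) hxy'
        gcongr
    _ = _ := by ring

/-- If a nonnegative combination of convex functions vanishes identically, then each function of
positive weight is affine. -/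
theorem map_combination_eq_of_sum_mul_eq_zero {E ι : Type*} [AddCommGroup E] [Module ℝ E]
    [Fintype ι] {g : ι → E → ℝ} (hg : ∀ i, ConvexOn ℝ univ (g i)) {w : ι → ℝ} (hw : ∀ i, 0 ≤ w i)
    (hsum : ∀ x, ∑ i, w i * g i x = 0) {i : ι} (hi : 0 < w i) (x y : E) {a b : ℝ} (ha : 0 ≤ a)
    (hb : 0 ≤ b) (hab : a + b = 1) : g i (a • x + b • y) = a * g i x + b * g i y := by
  have h1 : ∀ j ∈ Finset.univ,
      w j * (g j (a • x + b • y) - (a * g j x + b * g j y)) ≤ 0 := fun j _ =>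
    mul_nonpos_of_nonneg_of_nonpos (hw j)
      (sub_nonpos.2 ((hg j).2 (mem_univ x) (mem_univ y) ha hb hab))
  have h2 : ∑ j, w j * (g j (a • x + b • y) - (a * g j x + b * g j y)) = 0 := by
    calc _ = ∑ j, w j * g j (a • x + b • y)
          - (a * ∑ j, w j * g j x + b * ∑ j, w j * g j y) := by
          rw [Finset.mul_sum, Finset.mul_sum, ← Finset.sum_add_distrib, ← Finset.sum_sub_distrib]
          exact Finset.sum_congr rfl fun j _ => by ring
      _ = 0 := by simp [hsum]
  have h3 := (Finset.sum_eq_zero_iff_of_nonpos h1).1 h2 i (Finset.mem_univ i)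
  rcases mul_eq_zero.1 h3 with h | h
  · exact absurd h hi.ne'
  · linarith

theorem isPolynomialOnRays_abs_of_map_combination_eq {E : Type*} [AddCommGroup E] [Module ℝ E]
    {d : ℕ} (hd : 0 < d) {f : E → ℝ} (h0 : f 0 = 0)
    (hf : ∀ x y (a b : ℝ), 0 ≤ a → 0 ≤ b → a + b = 1 → f (a • x + b • y) = a * f x + b * f y) :
    IsPolynomialOnRays d fun x => |f x| := by
  have hle : ∀ t ∈ Icc (0 : ℝ) 1, ∀ v, f (t • v) = t * f v := fun t ht v => by
    simpa [h0] using hf v 0 t (1 - t) ht.1 (sub_nonneg.2 ht.2) (by ring)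
  intro v
  refine ⟨Polynomial.C |f v| * Polynomial.X,
    (Polynomial.natDegree_C_mul_le _ _).trans (Polynomial.natDegree_X_le.trans hd), fun t ht => ?_⟩
  have : f (t • v) = t * f v := by
    rcases le_total t 1 with h | h
    · exact hle t ⟨ht, h⟩ v
    · have ht0 : 0 < t := by linarith
      have := hle t⁻¹ ⟨by positivity, inv_le_one_of_one_le₀ h⟩ (t • v)
      rw [smul_smul, inv_mul_cancel₀ ht0.ne', one_smul] at this
      rw [this, mul_inv_cancel_left₀ ht0.ne']
  simp only [this, abs_mul, abs_of_nonneg ht, Polynomial.eval_mul, Polynomial.eval_C,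
    Polynomial.eval_X]
  ring

theorem holderErrorBound_of_finrank_le.{u, v} {d : ℕ} (hd : 0 < d) {ι : Type v} [Fintype ι]
    (k : ℕ) : ∀ {E : Type u} [NormedAddCommGroup E] [InnerProductSpace ℝ E]
      [FiniteDimensional ℝ E] (_ : Module.finrank ℝ E ≤ k) {g : ι → E → ℝ}
      (_ : ∀ i, ConvexOn ℝ univ (g i)) (_ : ∀ i, IsPolynomialOnLines d (g i))
      (_ : ∀ i, g i 0 ≤ 0), HolderErrorBound g (((d : ℝ)⁻¹) ^ k) := by
  have hd1 : (1 : ℝ) ≤ d := by exact_mod_cast hd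
  have hdi0 : (0 : ℝ) < (d : ℝ)⁻¹ := by positivity
  have hdi1 : (d : ℝ)⁻¹ ≤ 1 := inv_le_one_of_one_le₀ hd1
  induction k with
  | zero =>
    intro E _ _ _ hE g hg hp h0
    have : Subsingleton E := Module.finrank_zero_iff.1 (Nat.le_zero.1 hE)
    refine ⟨1, one_pos, 1, one_pos, fun x hx r hr hgr => ⟨0, h0, ?_⟩⟩
    rw [Subsingleton.elim x 0]
    simpa using hr
  | succ k ih =>
    intro E _ _ _ hE g hg hp h0
    have key : ∀ h : E → ℝ, ConvexOn ℝ univ h → (∀ x, 0 ≤ h x) → h 0 = 0 →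
        IsPolynomialOnRays d h → (∀ v, h v = 0 → h (-v) = 0) → (∃ x, h x ≠ 0) →
        (∃ C > 0, ∀ x r, 0 ≤ r → (∀ i, g i x ≤ r) → h x ≤ C * r) →
        HolderErrorBound g ((d : ℝ)⁻¹ ^ (k + 1)) := by
      rintro h hconv hnn hh0 hray hneg ⟨x₀, hx₀⟩ ⟨C, hC, hCr⟩
      set V := zeroSubmodule hray hconv hnn hh0 hneg with hVdef
      have hV : ∀ v, v ∈ V ↔ h v = 0 := fun v => Iff.rfl
      obtain ⟨c, hc, hcV⟩ :=
        exists_mul_norm_sub_starProjection_pow_le hd hray hconv hnn hh0 hV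
      have hVtop : V ≠ ⊤ := fun ht => hx₀ ((hV x₀).1 (ht ▸ Submodule.mem_top))
      have hfin : Module.finrank ℝ V ≤ k :=
        Nat.lt_succ_iff.1 ((Submodule.finrank_lt hVtop).trans_le hE)
      have hVb : HolderErrorBound (fun i (x : V) => g i x) ((d : ℝ)⁻¹ ^ k) := by
        refine ih hfin (fun i => ?_) (fun i v => ?_) (fun i => ?_)
        · exact (hg i).comp_linearMap V.subtype
        · exact hp i v
        · exact h0 i
      rw [pow_succ]
      refine HolderErrorBound.of_submodule hg h0 (pow_pos hdi0 k)
        (pow_le_one₀ hdi0.le hdi1) hdi0 hdi1 hVb (C := (C / c) ^ (d : ℝ)⁻¹) (by positivity)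
        fun x hx r hr hgr => ?_
      rw [← Real.mul_rpow (by positivity) hr]
      refine (Real.le_rpow_inv_iff_of_pos (norm_nonneg _) (by positivity) (by linarith)).2 ?_
      rw [Real.rpow_natCast, div_mul_eq_mul_div, le_div_iff₀ hc, mul_comm]
      exact (hcV x hx).trans (hCr x r hr hgr)
    classical
    let J := {i : ι // ∃ x, g i x ≠ 0}
    by_cases hsl : ∃ z, ∀ j : J, g j z < 0
    · obtain ⟨z, hz⟩ := hsl
      refine HolderErrorBound.of_slater hg h0 (z := z) (fun i => ?_) (by positivity)
        (pow_le_one₀ hdi0.le hdi1)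
      by_cases hi : ∃ x, g i x ≠ 0
      · exact Or.inl (hz ⟨i, hi⟩)
      · push Not at hi
        exact Or.inr fun x => (hi x).le
    obtain ⟨w, hw, ⟨i, hi⟩, hsum⟩ :=
      exists_weights_of_forall_not_neg (fun j : J => hg j) hsl
    have hwsum : 0 < ∑ j, w j :=
      Finset.sum_pos' (fun j _ => hw j) ⟨i, Finset.mem_univ i, hi⟩
    set h : E → ℝ := fun x => ∑ j, w j * g j x with hh
    have hh0 : h 0 = 0 :=
      le_antisymm (Finset.sum_nonpos fun j _ =>
        mul_nonpos_of_nonneg_of_nonpos (hw j) (h0 j)) (hsum 0)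
    have hhr : ∀ x r, (∀ i, g i x ≤ r) → h x ≤ (∑ j, w j) * r := by
      intro x r hgr
      rw [Finset.sum_mul]
      exact Finset.sum_le_sum fun j _ => mul_le_mul_of_nonneg_left (hgr j) (hw j)
    by_cases hz : ∃ x, h x ≠ 0
    · have hpl : IsPolynomialOnLines d h := IsPolynomialOnLines.sum_mul (fun j : J => hp j) w
      have hconv : ConvexOn ℝ univ h := by
        refine ⟨convex_univ, fun x _ y _ a b ha hb hab => ?_⟩
        simp only [hh, smul_eq_mul]
        rw [Finset.mul_sum, Finset.mul_sum, ← Finset.sum_add_distrib]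
        refine Finset.sum_le_sum fun j _ => ?_
        have := mul_le_mul_of_nonneg_left
          ((hg j).2 (mem_univ x) (mem_univ y) ha hb hab) (hw j)
        simp only [smul_eq_mul] at this
        linarith
      refine key h hconv hsum hh0 hpl.isPolynomialOnRays (fun v hv => ?_) hz
        ⟨_, hwsum, fun x r _ => hhr x r⟩
      obtain ⟨p, -, hpe⟩ := hpl v
      have hp0 : p = 0 := by
        refine Polynomial.eq_zero_of_infinite_isRoot p
          ((Icc_infinite (zero_lt_one (α := ℝ))).mono fun s hs => ?_)
        change p.eval s = 0
        rw [← hpe s]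
        refine le_antisymm ?_ (hsum _)
        simpa [hv] using hconv.apply_smul_le hh0 hs v
      have := hpe (-1)
      rwa [hp0, Polynomial.eval_zero, neg_one_smul] at this
    push Not at hz
    have haff : ∀ x y (a b : ℝ), 0 ≤ a → 0 ≤ b → a + b = 1 →
        g i (a • x + b • y) = a * g i x + b * g i y := fun x y a b ha hb hab =>
      map_combination_eq_of_sum_mul_eq_zero (fun j : J => hg j) hw hz hi x y ha hb hab
    have hgi0 : g i 0 = 0 := by
      have := (Finset.sum_eq_zero_iff_of_nonpos fun j _ =>
        mul_nonpos_of_nonneg_of_nonpos (hw j) (h0 j)).1 hh0 i (Finset.mem_univ i)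
      exact (mul_eq_zero.1 this).resolve_left hi.ne'
    refine key (fun x => |g i x|) ⟨convex_univ, fun x _ y _ a b ha hb hab => ?_⟩
      (fun x => abs_nonneg _) (by simp [hgi0])
      (isPolynomialOnRays_abs_of_map_combination_eq hd hgi0 haff) (fun v hv => ?_)
      (i.2.imp fun x hx => abs_ne_zero.2 hx)
      ⟨(∑ j, w j) / w i, by positivity, fun x r hr hgr => ?_⟩
    · simp only [haff x y a b ha hb hab, smul_eq_mul]
      refine (abs_add_le _ _).trans_eq ?_
      rw [abs_mul, abs_mul, abs_of_nonneg ha, abs_of_nonneg hb]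
    · have := haff v (-v) (1 / 2) (1 / 2) (by norm_num) (by norm_num) (by norm_num)
      simp only [abs_eq_zero] at hv ⊢
      rw [smul_neg, add_neg_cancel, hgi0, hv] at this
      linarith
    · rw [div_mul_eq_mul_div, le_div_iff₀ hi]
      have hwi : w i ≤ ∑ j, w j :=
        Finset.single_le_sum (fun j _ => hw j) (Finset.mem_univ i)
      have hrest : ∑ j ∈ Finset.univ.erase i, w j * g j x ≤ (∑ j, w j) * r := by
        rw [Finset.sum_mul]
        refine (Finset.sum_le_sum fun (j : J) _ => mul_le_mul_of_nonneg_left (hgr j) (hw j)).trans ?_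
        exact Finset.sum_le_sum_of_subset_of_nonneg (Finset.erase_subset _ _)
          fun j _ _ => mul_nonneg (hw j) hr
      have hsplit := Finset.add_sum_erase Finset.univ (fun j => w j * g j x) (Finset.mem_univ i)
      have hzx : ∑ j, w j * g j x = 0 := hz x
      have h1 : w i * g i x ≤ (∑ j, w j) * r :=
        (mul_le_mul_of_nonneg_left (hgr i) hi.le).trans (mul_le_mul_of_nonneg_right hwi hr)
      have h2 : |g i x| * w i = |w i * g i x| := by rw [abs_mul, abs_of_pos hi, mul_comm]
      rw [h2, abs_le]
      constructor <;> linarith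

end HolderErrorBound

theorem MvPolynomial.exists_natDegree_le_eval_add_mul {σ : Type*} {d : ℕ} (p : MvPolynomial σ ℝ)
    (hp : p.totalDegree ≤ d) (a v : σ → ℝ) : ∃ q : Polynomial ℝ, q.natDegree ≤ d ∧
      ∀ t : ℝ, MvPolynomial.eval (fun j => a j + t * v j) p = q.eval t := by
  refine ⟨MvPolynomial.aeval (fun j => Polynomial.C (v j) * Polynomial.X + Polynomial.C (a j)) p,
    ?_, fun t => ?_⟩
  · simpa using MvPolynomial.aeval_natDegree_le p hp
      (fun j => Polynomial.C (v j) * Polynomial.X + Polynomial.C (a j))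
      (fun j => Polynomial.natDegree_linear_le)
  · rw [MvPolynomial.aeval_def, MvPolynomial.polynomial_eval_eval₂, MvPolynomial.eval,
      MvPolynomial.coe_eval₂Hom]
    congr 1
    · ext; simp
    · ext j; simp; ring

theorem max_two_div_one_div_choose_mul_le {n d : ℕ} (hd : 0 < d) :
    max (2 / ((2 * (d : ℝ) - 1) ^ n + 1))
      (1 / ((Nat.choose (n - 1) ((n - 1) / 2) : ℝ) * (d : ℝ) ^ n)) ≤ (d : ℝ)⁻¹ ^ n := by
  have hd1 : (1 : ℝ) ≤ d := by exact_mod_cast hd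
  have hdn : (0 : ℝ) < (d : ℝ) ^ n := by positivity
  have hnn : 0 ≤ 2 * (d : ℝ) - 1 := by linarith
  rw [inv_pow, ← one_div]
  refine max_le ?_ ?_
  · rw [div_le_div_iff₀ (by positivity) hdn]
    have := (convexOn_pow n).2 (mem_Ici.2 hnn) (mem_Ici.2 zero_le_one)
      (by norm_num : (0 : ℝ) ≤ 1 / 2) (by norm_num : (0 : ℝ) ≤ 1 / 2) (by norm_num)
    simp only [smul_eq_mul, one_pow] at this
    have h2 : (1 / 2 : ℝ) * (2 * d - 1) + 1 / 2 * 1 = d := by ring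
    rw [h2] at this
    linarith
  · have h1 : (1 : ℝ) ≤ (Nat.choose (n - 1) ((n - 1) / 2) : ℝ) := by
      exact_mod_cast Nat.choose_pos (Nat.div_le_self _ _)
    exact one_div_le_one_div_of_le hdn (le_mul_of_one_le_left hdn.le h1)

/-- Local error bound with explicit Hölder exponent for convex polynomial systems
(Corollary 3.2). -/
theorem local_error_bound_convex_polynomial_system_corollary
    (n m d : ℕ) (hn : 0 < n) (hm : 0 < m) (hd : 0 < d)
    (g : Fin m → EuclideanSpace ℝ (Fin n) → ℝ)
    (hpoly : ∀ i, ∃ p : MvPolynomial (Fin n) ℝ, p.totalDegree ≤ d ∧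
      ∀ x : EuclideanSpace ℝ (Fin n), g i x = MvPolynomial.eval (fun j => x j) p)
    (hconv : ∀ i, ConvexOn ℝ Set.univ (g i))
    (S : Set (EuclideanSpace ℝ (Fin n)))
    (hS : S = {x | ∀ i, g i x ≤ 0})
    (xbar : EuclideanSpace ℝ (Fin n)) (hxbar : xbar ∈ S)
    (τ : ℝ)
    (hτ : τ = max (2 / ((2 * (d : ℝ) - 1) ^ n + 1))
                  (1 / ((Nat.choose (n - 1) ((n - 1) / 2) : ℝ) * (d : ℝ) ^ n))) :
    ∃ c > (0 : ℝ), ∃ ε > (0 : ℝ), ∀ x : EuclideanSpace ℝ (Fin n), ‖x - xbar‖ ≤ ε →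
      Metric.infDist x S ≤ c * (⨆ i, max (g i x) 0) ^ τ := by
  have hd1 : (1 : ℝ) ≤ d := by exact_mod_cast hd
  have hτ1 : τ ≤ (d : ℝ)⁻¹ ^ n := hτ ▸ max_two_div_one_div_choose_mul_le hd
  have hτ0 : 0 ≤ τ := hτ ▸ le_max_of_le_right (by positivity)
  subst hS
  have hb : HolderErrorBound (fun i x => g i (xbar + x)) ((d : ℝ)⁻¹ ^ n) := by
    refine holderErrorBound_of_finrank_le hd n (by simp) (fun i => ?_) (fun i v => ?_) fun i => ?_
    · exact (hconv i).translate_right xbar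
    · obtain ⟨p, hpd, hpe⟩ := hpoly i
      obtain ⟨q, hqd, hqe⟩ :=
        p.exists_natDegree_le_eval_add_mul hpd (fun j => xbar j) (fun j => v j)
      exact ⟨q, hqd, fun t => by simp [hpe, ← hqe]⟩
    · simpa using hxbar i
  obtain ⟨c, hc, ε, hε, H⟩ := hb
  refine ⟨max c ε, lt_max_of_lt_left hc, ε, hε, fun x hx => ?_⟩
  set r := ⨆ i, max (g i x) 0 with hr
  have hr0 : 0 ≤ r := Real.iSup_nonneg fun i => le_max_right _ _
  have hgr : ∀ i, g i x ≤ r := fun i =>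
    (le_max_left _ _).trans (le_ciSup (f := fun i => max (g i x) 0) (finite_range _).bddAbove i)
  rcases le_total r 1 with hr1 | hr1
  · obtain ⟨y, hy, hxy⟩ := H (x - xbar) hx r hr0 fun i => by simpa using hgr i
    calc infDist x {x | ∀ i, g i x ≤ 0} ≤ dist x (xbar + y) := infDist_le_dist_of_mem hy
      _ = ‖x - xbar - y‖ := by rw [dist_eq_norm, sub_sub]
      _ ≤ c * r ^ ((d : ℝ)⁻¹ ^ n) := hxy
      _ ≤ max c ε * r ^ τ := by
        gcongr ?_ * ?_
        · exact le_max_left _ _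
        · exact Real.rpow_le_rpow_of_exponent_ge' hr0 hr1 hτ0 hτ1
  · calc infDist x {x | ∀ i, g i x ≤ 0} ≤ dist x xbar := infDist_le_dist_of_mem hxbar
      _ ≤ max c ε * 1 := by
        rw [dist_eq_norm, mul_one]
        exact hx.trans (le_max_right _ _)
      _ ≤ max c ε * r ^ τ := by
        gcongr
        exact Real.one_le_rpow hr1 hτ0
end
end

section
/- Let n, m, d be positive integers, let γ_1, …, γ_m be positive integers, and for each i = 1, …, m and j = 1, …, γ_i let g_{i,j} be a convex polynomial on ℝ^n of degree at most d. Set C_i := {x ∈ ℝ^n : g_{i,j}(x) ≤ 0 for j = 1, …, γ_i} and assume C := ⋂_{i=1}^m C_i is nonempty. Let x_0 ∈ ℝ^n and let (x_k) be the sequence of cyclic projections onto C_1, …, C_m starting at x_0. Then (x_k) converges to some x_∞ ∈ C, and there exist M > 0 and r_0 ∈ (0, 1) such that for all k ≥ 1: if d > 1 then ‖x_k − x_∞‖ ≤ M·k^{−ρ}, and if d = 1 then ‖x_k − x_∞‖ ≤ M·r_0^k, where ρ := 1/min{(2d−1)^n − 1, 2·β(n−1)·d^n − 2}. -/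
open Metric Set Filter
open scoped BigOperators

noncomputable section

/-- The restriction of `f` to every line is a polynomial of degree at most `d`. -/
def PolynomialOnLines {E : Type*} [AddCommGroup E] [Module ℝ E] (d : ℕ) (f : E → ℝ) : Prop :=
  ∀ x v : E, ∃ p : Polynomial ℝ, p.natDegree ≤ d ∧ ∀ t : ℝ, f (x + t • v) = p.eval t

theorem Polynomial.abs_eval_le_sum_abs_coeff_mul_pow {p : Polynomial ℝ} {d : ℕ}
    (hp : p.natDegree ≤ d) {s : ℝ} (hs : 1 ≤ s) :
    |p.eval s| ≤ (∑ k ∈ Finset.range (d + 1), |p.coeff k|) * s ^ d := by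
  rw [Polynomial.eval_eq_sum_range' (Nat.lt_succ_of_le hp), Finset.sum_mul]
  refine (Finset.abs_sum_le_sum_abs _ _).trans (Finset.sum_le_sum fun k hk => ?_)
  rw [abs_mul, abs_of_nonneg (by positivity : (0 : ℝ) ≤ s ^ k)]
  have hkd : k ≤ d := by simpa [Nat.lt_succ_iff] using hk
  gcongr

theorem Polynomial.exists_abs_eval_le_mul_pow (d : ℕ) :
    ∃ K > (0 : ℝ), ∀ p : Polynomial ℝ, p.natDegree ≤ d → ∀ M : ℝ,
      (∀ t ∈ Icc (0 : ℝ) 1, |p.eval t| ≤ M) → ∀ s : ℝ, 1 ≤ s → |p.eval s| ≤ K * s ^ d * M := by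
  let v : Fin (d + 1) → ℝ := fun i => 1 / ((i : ℝ) + 1)
  have hv : Function.Injective v := by
    intro i j hij
    have h : (i : ℝ) = j := by
      have := hij
      simp only [v, one_div, inv_inj, add_left_inj] at this
      exact this
    exact Fin.ext (by exact_mod_cast h)
  have hmem : ∀ i, v i ∈ Icc (0 : ℝ) 1 := fun i => by
    refine ⟨by positivity, ?_⟩
    rw [div_le_one (by positivity)]
    linarith [(Nat.cast_nonneg i.1 : (0 : ℝ) ≤ _)]
  let b : Fin (d + 1) → Polynomial ℝ := Lagrange.basis Finset.univ v
  have hb : ∀ i, (b i).natDegree ≤ d := fun i =>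
    (Lagrange.natDegree_basis (hv.injOn) (Finset.mem_univ i)).le.trans (by simp)
  let K : ℝ := ∑ i, ∑ k ∈ Finset.range (d + 1), |(b i).coeff k|
  have hK : 0 ≤ K := by positivity
  refine ⟨K + 1, by positivity, fun p hp M hM s hs => ?_⟩
  have hM0 : 0 ≤ M := (abs_nonneg _).trans (hM 0 (by simp))
  have hpe : p = Lagrange.interpolate Finset.univ v (fun i => p.eval (v i)) := by
    refine Lagrange.eq_interpolate hv.injOn ?_
    refine (Polynomial.degree_le_of_natDegree_le hp).trans_lt ?_
    rw [Finset.card_univ, Fintype.card_fin]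
    exact_mod_cast Nat.lt_succ_self d
  have hps : p.eval s = ∑ i, p.eval (v i) * (b i).eval s := by
    conv_lhs => rw [hpe]
    simp [Lagrange.interpolate_apply, Polynomial.eval_finsetSum, b]
  rw [hps]
  calc |∑ i, p.eval (v i) * (b i).eval s| ≤ ∑ i, |p.eval (v i) * (b i).eval s| :=
        Finset.abs_sum_le_sum_abs _ _
    _ ≤ ∑ i, M * ((∑ k ∈ Finset.range (d + 1), |(b i).coeff k|) * s ^ d) := by
        refine Finset.sum_le_sum fun i _ => ?_
        rw [abs_mul]
        exact mul_le_mul (hM _ (hmem i)) (Polynomial.abs_eval_le_sum_abs_coeff_mul_pow (hb i) hs)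
          (abs_nonneg _) hM0
    _ = K * s ^ d * M := by rw [← Finset.mul_sum, ← Finset.sum_mul]; ring
    _ ≤ (K + 1) * s ^ d * M := by gcongr; linarith

theorem ConvexOn.le_mul_of_map_zero {E : Type*} [AddCommGroup E] [Module ℝ E] {h : E → ℝ}
    (hc : ConvexOn ℝ univ h) (h0 : h 0 = 0) {t : ℝ} (ht0 : 0 ≤ t) (ht1 : t ≤ 1) (x : E) :
    h (t • x) ≤ t * h x := by
  have := hc.2 (mem_univ x) (mem_univ (0 : E)) ht0 (sub_nonneg.2 ht1) (by ring)
  simpa [h0] using this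

theorem ConvexOn.exists_growth_of_polynomialOnLines {E : Type*} [AddCommGroup E] [Module ℝ E]
    {h : E → ℝ} {d : ℕ} (hc : ConvexOn ℝ univ h) (hp : PolynomialOnLines d h)
    (hpos : ∀ x, 0 ≤ h x) (h0 : h 0 = 0) :
    ∃ K > (0 : ℝ), ∀ (x : E) (s : ℝ), 1 ≤ s → h (s • x) ≤ K * s ^ d * h x := by
  obtain ⟨K, hK, H⟩ := Polynomial.exists_abs_eval_le_mul_pow d
  refine ⟨K, hK, fun x s hs => ?_⟩
  obtain ⟨p, hpd, hpe⟩ := hp 0 x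
  simp only [zero_add] at hpe
  rw [hpe]
  refine (le_abs_self _).trans (H p hpd _ (fun t ht => ?_) s hs)
  rw [← hpe, abs_of_nonneg (hpos _)]
  exact (hc.le_mul_of_map_zero h0 ht.1 ht.2 x).trans
    (mul_le_of_le_one_left (hpos x) ht.2)

theorem ConvexOn.eq_zero_neg_of_polynomialOnLines {E : Type*} [AddCommGroup E] [Module ℝ E]
    {h : E → ℝ} {d : ℕ} (hc : ConvexOn ℝ univ h) (hp : PolynomialOnLines d h)
    (hpos : ∀ x, 0 ≤ h x) (h0 : h 0 = 0) {v : E} (hv : h v = 0) : h (-v) = 0 := by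
  obtain ⟨p, -, hpe⟩ := hp 0 v
  simp only [zero_add] at hpe
  have hz : p = 0 := by
    refine Polynomial.eq_zero_of_infinite_isRoot p ((Icc_infinite (zero_lt_one' ℝ)).mono ?_)
    intro t ht
    have := hc.le_mul_of_map_zero h0 ht.1 ht.2 v
    rw [hv, mul_zero] at this
    exact (hpe t).symm.trans (le_antisymm this (hpos _))
  have := hpe (-1)
  simpa [hz] using this

theorem exists_nonneg_combination_of_no_strict_solution {E ι : Type*} [AddCommGroup E]
    [Module ℝ E] [Fintype ι] {g : ι → E → ℝ} (hc : ∀ j, ConvexOn ℝ univ (g j))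
    (hno : ¬ ∃ x, ∀ j, g j x < 0) :
    ∃ l : ι → ℝ, (∀ j, 0 ≤ l j) ∧ (∃ j, 0 < l j) ∧ ∀ x, 0 ≤ ∑ j, l j * g j x := by
  classical
  let S : Set (ι → ℝ) := {u | ∃ x, ∀ j, g j x < u j}
  have hSo : IsOpen S := by
    have : S = ⋃ x, univ.pi fun j => Ioi (g j x) := by
      ext u; simp [S]
    rw [this]
    exact isOpen_iUnion fun x => isOpen_set_pi finite_univ fun j _ => isOpen_Ioi
  have hSc : Convex ℝ S := by
    rintro u ⟨x, hx⟩ w ⟨y, hy⟩ a b ha hb hab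
    refine ⟨a • x + b • y, fun j => ?_⟩
    refine ((hc j).2 (mem_univ x) (mem_univ y) ha hb hab).trans_lt ?_
    simp only [smul_eq_mul, Pi.add_apply, Pi.smul_apply]
    rcases ha.eq_or_lt with rfl | ha
    · have : b = 1 := by linarith
      subst this
      simpa using hy j
    · have := mul_lt_mul_of_pos_left (hx j) ha
      have := mul_le_mul_of_nonneg_left (hy j).le hb
      linarith
  have h0 : (0 : ι → ℝ) ∉ S := fun ⟨x, hx⟩ => hno ⟨x, hx⟩
  obtain ⟨f, hf⟩ := geometric_hahn_banach_point_open hSc hSo h0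
  simp only [map_zero] at hf
  let l : ι → ℝ := fun j => f (Pi.single j 1)
  have hfl : ∀ u, f u = ∑ j, l j * u j := fun u => by
    conv_lhs => rw [pi_eq_sum_univ' u, map_sum]
    refine Finset.sum_congr rfl fun j _ => ?_
    rw [map_smul, smul_eq_mul, mul_comm]
  have hS1 : (fun j => g j 0 + 1) ∈ S := ⟨0, fun j => by linarith⟩
  have hl : ∀ j, 0 ≤ l j := by
    intro j
    by_contra! hneg
    have hT : 0 ≤ -(f (fun j => g j 0 + 1)) / l j :=
      div_nonneg_of_nonpos (by linarith [hf _ hS1]) hneg.le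
    have := hf ((fun j => g j 0 + 1) + (-(f (fun j => g j 0 + 1)) / l j) • Pi.single j 1)
      ⟨0, fun i => by
        have : 0 ≤ (-(f (fun j => g j 0 + 1)) / l j) * (Pi.single j 1 : ι → ℝ) i :=
          mul_nonneg hT (by by_cases h : i = j <;> simp [h])
        simp only [Pi.add_apply, Pi.smul_apply, smul_eq_mul]
        linarith⟩
    rw [map_add, map_smul, smul_eq_mul, div_mul_cancel₀ _ hneg.ne] at this
    linarith
  refine ⟨l, hl, ?_, fun x => ?_⟩
  · by_contra! hle
    have := hf _ hS1
    rw [hfl] at this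
    exact absurd this (not_lt.2 (Finset.sum_nonpos fun j _ => by
      rw [le_antisymm (hle j) (hl j), zero_mul]))
  · have hs : 0 ≤ ∑ j, l j := Finset.sum_nonneg fun j _ => hl j
    refine le_of_forall_pos_le_add fun δ hδ => ?_
    have := hf (fun j => g j x + δ / (∑ j, l j + 1))
      ⟨x, fun j => by have : 0 < δ / (∑ j, l j + 1) := by positivity
                      linarith⟩
    rw [hfl] at this
    simp only [mul_add, Finset.sum_add_distrib, ← Finset.sum_mul] at this
    have h2 : (∑ j, l j) * (δ / (∑ j, l j + 1)) ≤ δ := by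
      rw [mul_div_assoc', div_le_iff₀ (by positivity)]
      nlinarith
    linarith

theorem ConvexOn.exists_submodule_pow_norm_sub_le {E : Type*} [NormedAddCommGroup E]
    [InnerProductSpace ℝ E] [FiniteDimensional ℝ E] {h : E → ℝ} {d : ℕ} {K : ℝ}
    (hd : 0 < d) (hc : ConvexOn ℝ univ h) (hpos : ∀ x, 0 ≤ h x) (h0 : h 0 = 0) (hK : 0 < K)
    (hgrow : ∀ (x : E) (s : ℝ), 1 ≤ s → h (s • x) ≤ K * s ^ d * h x)
    (hsymm : ∀ v, h v = 0 → h (-v) = 0) (hne : ∃ z, h z ≠ 0) :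
    ∃ W : Submodule ℝ E, W ≠ ⊤ ∧ ∀ R > (0 : ℝ), ∃ c > (0 : ℝ), ∀ x, ‖x‖ ≤ R →
      ∃ w ∈ W, ‖w‖ ≤ ‖x‖ ∧ ‖x - w‖ ^ d ≤ c * h x := by
  have hsmul : ∀ (t : ℝ) v, 0 ≤ t → h v = 0 → h (t • v) = 0 := by
    intro t v ht hv
    refine le_antisymm ?_ (hpos _)
    rcases le_total t 1 with h1 | h1
    · simpa [hv] using hc.le_mul_of_map_zero h0 ht h1 v
    · simpa [hv] using hgrow v t h1
  have hmid : ∀ u v, h (u + v) ≤ (1 / 2) * h ((2 : ℝ) • u) + (1 / 2) * h ((2 : ℝ) • v) := by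
    intro u v
    have := hc.2 (mem_univ ((2 : ℝ) • u)) (mem_univ ((2 : ℝ) • v))
      (by norm_num : (0 : ℝ) ≤ 1 / 2) (by norm_num : (0 : ℝ) ≤ 1 / 2) (by norm_num)
    simpa [smul_smul] using this
  let W : Submodule ℝ E :=
    { carrier := {v | h v = 0}
      zero_mem' := h0
      add_mem' := by
        intro u v hu hv
        refine le_antisymm ((hmid u v).trans ?_) (hpos _)
        rw [hsmul 2 u (by norm_num) hu, hsmul 2 v (by norm_num) hv]
        norm_num
      smul_mem' := by
        intro t v hv
        rcases le_total 0 t with ht | ht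
        · exact hsmul t v ht hv
        · have := hsymm _ (hsmul (-t) v (by linarith) hv)
          simpa using this }
  have hW : ∀ v, v ∈ W ↔ h v = 0 := fun v => Iff.rfl
  refine ⟨W, ?_, fun R hR => ?_⟩
  · rintro htop
    obtain ⟨z, hz⟩ := hne
    exact hz ((hW z).1 (htop ▸ Submodule.mem_top))
  have hcont : Continuous h := hc.locallyLipschitz.continuous
  obtain ⟨μ, hμ, hμle⟩ : ∃ μ > (0 : ℝ), ∀ y ∈ Wᗮ, ‖y‖ = R → μ ≤ h y := by
    have hcomp : IsCompact ((Wᗮ : Set E) ∩ sphere 0 R) :=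
      (isCompact_sphere 0 R).inter_left (Submodule.isClosed_orthogonal W)
    rcases ((Wᗮ : Set E) ∩ sphere 0 R).eq_empty_or_nonempty with he | he
    · refine ⟨1, one_pos, fun y hy hyR => ?_⟩
      have : y ∈ (Wᗮ : Set E) ∩ sphere 0 R := ⟨hy, by simpa using hyR⟩
      rw [he] at this
      exact this.elim
    · obtain ⟨y₀, hy₀, hmin⟩ := hcomp.exists_isMinOn he hcont.continuousOn
      refine ⟨h y₀, lt_of_le_of_ne (hpos _) fun h' => ?_, fun y hy hyR =>
        hmin ⟨hy, by simpa using hyR⟩⟩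
      have h1 : inner ℝ y₀ y₀ = 0 := hy₀.1 y₀ ((hW _).2 h'.symm)
      have h2 : ‖y₀‖ = R := by simpa using hy₀.2
      rw [inner_self_eq_zero] at h1
      rw [h1, norm_zero] at h2
      exact hR.ne h2
  refine ⟨K * R ^ d / μ * (K * 2 ^ d) + K * 2 ^ d, by positivity, fun x hx => ?_⟩
  refine ⟨W.starProjection x, W.starProjection_apply_mem x,
    W.norm_starProjection_apply_le x, ?_⟩
  set w := W.starProjection x with hw
  have hwW : w ∈ W := W.starProjection_apply_mem x
  have hy : x - w ∈ Wᗮ := W.sub_starProjection_mem_orthogonal x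
  have hynorm : ‖x - w‖ ≤ R := by
    have h1 : x - w = Wᗮ.starProjection x := by
      rw [← W.starProjection_add_starProjection_orthogonal x]
      simp [hw]
    rw [h1]
    exact (Wᗮ.norm_starProjection_apply_le x).trans hx
  have hhy : h (x - w) ≤ K * 2 ^ d * h x := by
    have h1 := hmid x (-w)
    rw [hsmul 2 (-w) (by norm_num) (hsymm w hwW), ← sub_eq_add_neg] at h1
    have h2 := hgrow x 2 (by norm_num)
    have h3 := hpos ((2 : ℝ) • x)
    linarith
  have hx0 := hpos x
  rcases (norm_nonneg (x - w)).eq_or_lt with h1 | h1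
  · rw [← h1, zero_pow hd.ne']
    positivity
  · have hs : 1 ≤ R / ‖x - w‖ := (one_le_div h1).2 hynorm
    have h2 := hgrow (x - w) _ hs
    have h3 := hμle ((R / ‖x - w‖) • (x - w)) (Wᗮ.smul_mem _ hy) (by
      rw [norm_smul, Real.norm_of_nonneg (by positivity), div_mul_cancel₀ _ h1.ne'])
    have h4 : μ * ‖x - w‖ ^ d ≤ K * R ^ d * h (x - w) := by
      have := h3.trans h2
      rw [div_pow] at this
      have h5 : 0 < ‖x - w‖ ^ d := by positivity
      calc μ * ‖x - w‖ ^ d ≤ (K * (R ^ d / ‖x - w‖ ^ d) * h (x - w)) * ‖x - w‖ ^ d := by gcongr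
        _ = K * R ^ d * h (x - w) := by field_simp
    calc ‖x - w‖ ^ d ≤ K * R ^ d / μ * h (x - w) := by
          rw [div_mul_eq_mul_div, le_div_iff₀ hμ]; linarith
      _ ≤ K * R ^ d / μ * (K * 2 ^ d * h x) := by gcongr
      _ ≤ _ := by
        have : 0 ≤ K * 2 ^ d * h x := by positivity
        linarith

theorem PolynomialOnLines.const_mul {E : Type*} [AddCommGroup E] [Module ℝ E] {d : ℕ}
    {f : E → ℝ} (hf : PolynomialOnLines d f) (a : ℝ) :
    PolynomialOnLines d (fun x => a * f x) := fun x v => by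
  obtain ⟨p, hp, he⟩ := hf x v
  exact ⟨Polynomial.C a * p, (Polynomial.natDegree_C_mul_le _ _).trans hp, fun t => by
    simp [he t]⟩

theorem PolynomialOnLines.sum {E ι : Type*} [AddCommGroup E] [Module ℝ E] [Fintype ι] {d : ℕ}
    {f : ι → E → ℝ} (hf : ∀ j, PolynomialOnLines d (f j)) :
    PolynomialOnLines d (fun x => ∑ j, f j x) := fun x v => by
  choose p hp he using fun j => hf j x v
  exact ⟨∑ j, p j, Polynomial.natDegree_sum_le_of_forall_le _ _ fun j _ => hp j, fun t => by
    simp [he, Polynomial.eval_finsetSum]⟩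

theorem PolynomialOnLines.comp_linearMap {E F : Type*} [AddCommGroup E] [Module ℝ E]
    [AddCommGroup F] [Module ℝ F] {d : ℕ} {f : E → ℝ} (hf : PolynomialOnLines d f)
    (A : F →ₗ[ℝ] E) : PolynomialOnLines d (fun x => f (A x)) := fun x v => by
  obtain ⟨p, hp, he⟩ := hf (A x) (A v)
  exact ⟨p, hp, fun t => by simp [he t]⟩

theorem convexOn_univ_sum_mul {E ι : Type*} [AddCommGroup E] [Module ℝ E] (s : Finset ι)
    {g : ι → E → ℝ} (hc : ∀ j, ConvexOn ℝ univ (g j)) {l : ι → ℝ} (hl : ∀ j, 0 ≤ l j) :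
    ConvexOn ℝ univ (fun x => ∑ j ∈ s, l j * g j x) := by
  classical
  induction s using Finset.induction_on with
  | empty => simpa using convexOn_const (0 : ℝ) convex_univ
  | insert a s ha ih =>
    simp only [Finset.sum_insert ha]
    exact ((hc a).smul (hl a)).add ih

/-- If the nonzero convex polynomials `g j` have no common strict solution, then some convex
nonnegative function that is not identically zero vanishes on the solution set and is controlled
by the residual. -/
theorem exists_convex_residual_of_no_strict_solution {E ι : Type*} [AddCommGroup E]
    [Module ℝ E] [Fintype ι] {d : ℕ} (hd : 0 < d) {g : ι → E → ℝ}
    (hc : ∀ j, ConvexOn ℝ univ (g j)) (hp : ∀ j, PolynomialOnLines d (g j))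
    (h0 : ∀ j, g j 0 ≤ 0) (hnz : ∀ j, ∃ z, g j z ≠ 0) (hno : ¬ ∃ x, ∀ j, g j x < 0) :
    ∃ h : E → ℝ, ∃ K > (0 : ℝ), ∃ B > (0 : ℝ), ConvexOn ℝ univ h ∧ (∀ x, 0 ≤ h x) ∧ h 0 = 0 ∧
      (∀ (x : E) (s : ℝ), 1 ≤ s → h (s • x) ≤ K * s ^ d * h x) ∧
      (∀ v, h v = 0 → h (-v) = 0) ∧ (∃ z, h z ≠ 0) ∧
      ∀ x ε, 0 ≤ ε → (∀ j, g j x ≤ ε) → h x ≤ B * ε := by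
  classical
  obtain ⟨l, hl, ⟨i, hi⟩, hpos⟩ := exists_nonneg_combination_of_no_strict_solution hc hno
  have hsum0 : ∑ j, l j * g j 0 = 0 :=
    le_antisymm (Finset.sum_nonpos fun j _ => mul_nonpos_of_nonneg_of_nonpos (hl j) (h0 j))
      (hpos 0)
  have hls : 0 ≤ ∑ j, l j := Finset.sum_nonneg fun j _ => hl j
  have hcs := convexOn_univ_sum_mul Finset.univ hc hl
  by_cases hz : ∃ z, ∑ j, l j * g j z ≠ 0
  · have hps : PolynomialOnLines d (fun x => ∑ j, l j * g j x) :=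
      PolynomialOnLines.sum fun j => (hp j).const_mul (l j)
    obtain ⟨K, hK, hgrow⟩ := hcs.exists_growth_of_polynomialOnLines hps hpos hsum0
    refine ⟨fun x => ∑ j, l j * g j x, K, hK, ∑ j, l j + 1, by positivity, hcs, hpos, hsum0,
      hgrow, fun v => hcs.eq_zero_neg_of_polynomialOnLines hps hpos hsum0, hz, ?_⟩
    intro x ε hε hx
    calc ∑ j, l j * g j x ≤ ∑ j, l j * ε :=
          Finset.sum_le_sum fun j _ => mul_le_mul_of_nonneg_left (hx j) (hl j)
      _ = (∑ j, l j) * ε := by rw [Finset.sum_mul]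
      _ ≤ _ := by linarith
  · push Not at hz
    have hsplit : ∀ x, g i x = -((l i)⁻¹ * ∑ j ∈ Finset.univ.erase i, l j * g j x) := by
      intro x
      have := hz x
      rw [← Finset.add_sum_erase _ _ (Finset.mem_univ i)] at this
      have h2 : ∑ j ∈ Finset.univ.erase i, l j * g j x = -(l i * g i x) := by linarith
      rw [h2]
      field_simp
    have hci : ConvexOn ℝ univ (fun x => -g i x) := by
      have := (convexOn_univ_sum_mul (Finset.univ.erase i) hc hl).smul (inv_nonneg.2 hi.le)
      refine this.congr fun x _ => ?_
      simp only [smul_eq_mul]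
      rw [hsplit x, neg_neg]
    have hi0 : g i 0 = 0 := by
      have := (Finset.sum_eq_zero_iff_of_nonpos fun j _ =>
        mul_nonpos_of_nonneg_of_nonpos (hl j) (h0 j)).1 hsum0 i (Finset.mem_univ i)
      exact (mul_eq_zero.1 this).resolve_left hi.ne'
    have hhom : ∀ (x : E) (t : ℝ), 0 ≤ t → t ≤ 1 → g i (t • x) = t * g i x := by
      intro x t ht0 ht1
      refine le_antisymm ((hc i).le_mul_of_map_zero hi0 ht0 ht1 x) ?_
      have := hci.le_mul_of_map_zero (by simp [hi0]) ht0 ht1 x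
      linarith
    have hneg : ∀ x, g i (-x) = -g i x := by
      intro x
      have h1 := (hc i).2 (mem_univ x) (mem_univ (-x))
        (by norm_num : (0 : ℝ) ≤ 1 / 2) (by norm_num : (0 : ℝ) ≤ 1 / 2) (by norm_num)
      have h2 := hci.2 (mem_univ x) (mem_univ (-x))
        (by norm_num : (0 : ℝ) ≤ 1 / 2) (by norm_num : (0 : ℝ) ≤ 1 / 2) (by norm_num)
      simp only [smul_neg, add_neg_cancel, hi0, smul_eq_mul] at h1 h2
      linarith
    refine ⟨fun x => |g i x|, 1, one_pos, (l i)⁻¹ * ∑ j ∈ Finset.univ.erase i, l j + 1, ?_, ?_,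
      fun x => abs_nonneg _, by simp [hi0], ?_, ?_, ?_, ?_⟩
    · have : 0 ≤ (l i)⁻¹ * ∑ j ∈ Finset.univ.erase i, l j :=
        mul_nonneg (inv_nonneg.2 hi.le) (Finset.sum_nonneg fun j _ => hl j)
      linarith
    · exact (hc i).sup hci
    · intro x s hs
      have hs0 : 0 < s := by linarith
      have := hhom (s • x) s⁻¹ (by positivity) (inv_le_one_of_one_le₀ hs)
      rw [smul_smul, inv_mul_cancel₀ hs0.ne', one_smul] at this
      have h2 : g i (s • x) = s * g i x := by rw [this]; field_simp
      simp only [h2, abs_mul, abs_of_pos hs0, one_mul]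
      gcongr
      exact le_self_pow₀ hs hd.ne'
    · intro v hv
      simpa [hneg] using hv
    · obtain ⟨z, hz⟩ := hnz i
      exact ⟨z, by simpa using hz⟩
    · intro x ε hε hx
      have h1 : 0 ≤ (l i)⁻¹ * ∑ j ∈ Finset.univ.erase i, l j :=
        mul_nonneg (inv_nonneg.2 hi.le) (Finset.sum_nonneg fun j _ => hl j)
      have h2 : 0 ≤ (l i)⁻¹ * (∑ j ∈ Finset.univ.erase i, l j) * ε := by positivity
      rw [abs_le]
      constructor
      · have : (l i)⁻¹ * ∑ j ∈ Finset.univ.erase i, l j * g j x ≤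
            (l i)⁻¹ * ((∑ j ∈ Finset.univ.erase i, l j) * ε) := by
          rw [Finset.sum_mul]
          exact mul_le_mul_of_nonneg_left (Finset.sum_le_sum fun j _ =>
            mul_le_mul_of_nonneg_left (hx j) (hl j)) (inv_nonneg.2 hi.le)
        rw [hsplit x]
        linarith
      · linarith [hx i]

theorem exists_lipschitz_bound_on_ball {E ι : Type*} [NormedAddCommGroup E] [NormedSpace ℝ E]
    [FiniteDimensional ℝ E] [Fintype ι] {g : ι → E → ℝ} (hc : ∀ j, ConvexOn ℝ univ (g j))
    (R : ℝ) : ∃ L > (0 : ℝ), ∀ j x y, ‖x‖ ≤ R → ‖y‖ ≤ R → g j y ≤ g j x + L * ‖x - y‖ := by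
  have hL : ∀ j, ∃ K, LipschitzOnWith K (g j) (closedBall 0 R) := fun j =>
    ((hc j).locallyLipschitz.locallyLipschitzOn).exists_lipschitzOnWith_of_compact
      (isCompact_closedBall 0 R)
  choose K hK using hL
  refine ⟨∑ j, (K j : ℝ) + 1, by positivity, fun j x y hx hy => ?_⟩
  have h1 := (hK j).dist_le_mul y (by simpa using hy) x (by simpa using hx)
  rw [Real.dist_eq, dist_comm, dist_eq_norm] at h1
  have h2 : (K j : ℝ) ≤ ∑ j, (K j : ℝ) :=
    Finset.single_le_sum (f := fun j => (K j : ℝ)) (fun j _ => (K j).2) (Finset.mem_univ j)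
  have h3 : (K j : ℝ) * ‖x - y‖ ≤ (∑ j, (K j : ℝ) + 1) * ‖x - y‖ := by
    gcongr; linarith
  linarith [le_abs_self (g j y - g j x)]

theorem exists_pow_error_bound_of_strict_solution {E ι : Type*} [NormedAddCommGroup E]
    [NormedSpace ℝ E] [Fintype ι] {g : ι → E → ℝ} (hc : ∀ j, ConvexOn ℝ univ (g j))
    {z : E} (hz : ∀ j, g j z < 0 ∨ ∀ x, g j x = 0) {D : ℕ} (hD : 0 < D) {R : ℝ} (hR : 0 < R) :
    ∃ c > (0 : ℝ), ∀ x, ‖x‖ ≤ R → ∀ ε, 0 ≤ ε → ε ≤ 1 → (∀ j, g j x ≤ ε) →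
      ∃ y, (∀ j, g j y ≤ 0) ∧ ‖x - y‖ ^ D ≤ c * ε := by
  obtain ⟨η, hη, hηz⟩ : ∃ η > (0 : ℝ), ∀ j, g j z ≤ -η ∨ ∀ x, g j x = 0 := by
    have : ∀ᶠ η in nhdsWithin (0 : ℝ) (Ioi 0), ∀ j, g j z ≤ -η ∨ ∀ x, g j x = 0 := by
      refine eventually_all.2 fun j => ?_
      rcases hz j with h | h
      · filter_upwards [Ioo_mem_nhdsGT (show (0 : ℝ) < -g j z by linarith)] with η hη
        exact Or.inl (by linarith [hη.2])
      · exact Eventually.of_forall fun _ => Or.inr h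
    obtain ⟨η, h1, h2⟩ := (this.and self_mem_nhdsWithin).exists
    exact ⟨η, h2, h1⟩
  refine ⟨((R + ‖z‖) / η) ^ D, by positivity, fun x hx ε hε hε1 hgx => ?_⟩
  have hpos : 0 < ε + η := by linarith
  refine ⟨(η / (ε + η)) • x + (ε / (ε + η)) • z, fun j => ?_, ?_⟩
  · rcases hηz j with h | h
    · refine ((hc j).2 (mem_univ x) (mem_univ z) (by positivity) (by positivity)
        (by field_simp; ring)).trans ?_
      simp only [smul_eq_mul]
      have h1 : η / (ε + η) * g j x ≤ η / (ε + η) * ε := by gcongr; exact hgx j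
      have h2 : ε / (ε + η) * g j z ≤ ε / (ε + η) * (-η) := by gcongr
      have h3 : η / (ε + η) * ε + ε / (ε + η) * (-η) = 0 := by field_simp; ring
      linarith
    · exact (h _).le
  · have h1 : x - ((η / (ε + η)) • x + (ε / (ε + η)) • z) = (ε / (ε + η)) • (x - z) := by
      have : (η / (ε + η)) = 1 - ε / (ε + η) := by field_simp; ring
      rw [this]
      module
    have h2 : ‖x - ((η / (ε + η)) • x + (ε / (ε + η)) • z)‖ ≤ (R + ‖z‖) / η * ε := by
      rw [h1, norm_smul, Real.norm_of_nonneg (by positivity)]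
      calc ε / (ε + η) * ‖x - z‖ ≤ ε / η * (R + ‖z‖) := by
            gcongr
            · linarith
            · exact (norm_sub_le _ _).trans (by linarith)
        _ = _ := by ring
    calc _ ≤ ((R + ‖z‖) / η * ε) ^ D := by gcongr
      _ = ((R + ‖z‖) / η) ^ D * ε ^ D := mul_pow _ _ _
      _ ≤ _ := by gcongr; exact pow_le_of_le_one hε hε1 hD.ne'

/-- A Hölder error bound with exponent `1 / d ^ N` for systems of convex polynomial inequalities
of degree at most `d` in dimension at most `N`. -/
theorem exists_holder_error_bound {ι : Type*} [Fintype ι] {d : ℕ} (hd : 0 < d) (N : ℕ) :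
    ∀ {E : Type*} [NormedAddCommGroup E] [InnerProductSpace ℝ E] [FiniteDimensional ℝ E]
      {g : ι → E → ℝ}, Module.finrank ℝ E ≤ N → (∀ j, ConvexOn ℝ univ (g j)) →
      (∀ j, PolynomialOnLines d (g j)) → (∀ j, g j 0 ≤ 0) → ∀ R > (0 : ℝ), ∃ c > (0 : ℝ),
      ∀ x, ‖x‖ ≤ R → ∀ ε, 0 ≤ ε → (∀ j, g j x ≤ ε) →
        ∃ y, (∀ j, g j y ≤ 0) ∧ ‖x - y‖ ^ (d ^ N) ≤ c * ε := by
  classical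
  induction N with
  | zero =>
    intro E _ _ _ g hN hc hp h0 R hR
    have : Subsingleton E := Module.finrank_zero_iff.1 (Nat.le_zero.1 hN)
    refine ⟨1, one_pos, fun x hx ε hε hgx => ⟨0, h0, ?_⟩⟩
    simpa [Subsingleton.elim x 0] using hε
  | succ N ih =>
    intro E _ _ _ g hN hc hp h0 R hR
    have hD : 0 < d ^ N := by positivity
    have hD1 : 0 < d ^ (N + 1) := by positivity
    suffices H : ∃ c > (0 : ℝ), ∀ x, ‖x‖ ≤ R → ∀ ε, 0 ≤ ε → ε ≤ 1 → (∀ j, g j x ≤ ε) →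
        ∃ y, (∀ j, g j y ≤ 0) ∧ ‖x - y‖ ^ (d ^ (N + 1)) ≤ c * ε by
      obtain ⟨c, hcpos, H⟩ := H
      refine ⟨c + R ^ d ^ (N + 1), by positivity, fun x hx ε hε hgx => ?_⟩
      rcases le_total ε 1 with h1 | h1
      · obtain ⟨y, hy, hxy⟩ := H x hx ε hε h1 hgx
        refine ⟨y, hy, hxy.trans ?_⟩
        gcongr
        linarith [show 0 < R ^ d ^ (N + 1) by positivity]
      · refine ⟨0, h0, ?_⟩
        rw [sub_zero]
        calc ‖x‖ ^ d ^ (N + 1) ≤ R ^ d ^ (N + 1) * 1 := by rw [mul_one]; gcongr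
          _ ≤ (c + R ^ d ^ (N + 1)) * ε := by gcongr; linarith
    by_cases hS : ∃ z, ∀ j, g j z < 0 ∨ ∀ x, g j x = 0
    · obtain ⟨z, hz⟩ := hS
      exact exists_pow_error_bound_of_strict_solution hc hz hD1 hR
    obtain ⟨h, K, hK, B, hB, hhc, hhpos, hh0, hgrow, hsymm, hne, hhB⟩ :=
      exists_convex_residual_of_no_strict_solution hd
        (g := fun j : {j // ∃ z, g j z ≠ 0} => g j.1) (fun j => hc j) (fun j => hp j)
        (fun j => h0 j) (fun j => j.2) (by
          rintro ⟨z, hz⟩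
          refine hS ⟨z, fun j => ?_⟩
          by_cases hj : ∃ z, g j z ≠ 0
          · exact Or.inl (hz ⟨j, hj⟩)
          · exact Or.inr (by simpa using hj))
    obtain ⟨W, hWtop, hW⟩ := hhc.exists_submodule_pow_norm_sub_le hd hhpos hh0 hK hgrow hsymm hne
    obtain ⟨c₁, hc₁, hW⟩ := hW R hR
    obtain ⟨L, hL, hLip⟩ := exists_lipschitz_bound_on_ball hc R
    have hWN : Module.finrank ℝ W ≤ N := by
      have := Submodule.finrank_lt hWtop
      omega
    obtain ⟨c₂, hc₂, hrec⟩ := ih (E := W) (g := fun j w => g j w) hWN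
      (fun j => (hc j).comp_linearMap W.subtype) (fun j => (hp j).comp_linearMap W.subtype)
      (fun j => by simpa using h0 j) R hR
    refine ⟨2 ^ (d ^ (N + 1)) * ((c₁ * B) ^ d ^ N + c₂ ^ d * (2 ^ d * (1 + L ^ d * (c₁ * B)))),
      by positivity, fun x hx ε hε hε1 hgx => ?_⟩
    obtain ⟨w, hwW, hwx, hxw⟩ := hW x hx
    have ha : ‖x - w‖ ^ d ≤ c₁ * B * ε := by
      calc _ ≤ c₁ * h x := hxw
        _ ≤ c₁ * (B * ε) := by gcongr; exact hhB x ε hε fun j => hgx j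
        _ = _ := by ring
    obtain ⟨y, hy, hwy⟩ := hrec ⟨w, hwW⟩ (hwx.trans hx) (ε + L * ‖x - w‖) (by positivity)
      (fun j => (hLip j x w hx (hwx.trans hx)).trans (by linarith [hgx j]))
    refine ⟨y, hy, ?_⟩
    have hb : ‖w - y‖ ^ d ^ N ≤ c₂ * (ε + L * ‖x - w‖) := hwy
    have h1 : ‖x - w‖ ^ d ^ (N + 1) ≤ (c₁ * B) ^ d ^ N * ε := by
      calc ‖x - w‖ ^ d ^ (N + 1) = (‖x - w‖ ^ d) ^ d ^ N := by rw [← pow_mul, pow_succ']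
        _ ≤ (c₁ * B * ε) ^ d ^ N := by gcongr
        _ = (c₁ * B) ^ d ^ N * ε ^ d ^ N := mul_pow _ _ _
        _ ≤ _ := by gcongr; exact pow_le_of_le_one hε hε1 hD.ne'
    have h2 : ‖w - y‖ ^ d ^ (N + 1) ≤ c₂ ^ d * (2 ^ d * (1 + L ^ d * (c₁ * B))) * ε := by
      calc ‖w - y‖ ^ d ^ (N + 1) = (‖w - y‖ ^ d ^ N) ^ d := by rw [← pow_mul, pow_succ]
        _ ≤ (c₂ * (ε + L * ‖x - w‖)) ^ d := by gcongr
        _ = c₂ ^ d * (ε + L * ‖x - w‖) ^ d := mul_pow _ _ _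
        _ ≤ c₂ ^ d * (2 ^ (d - 1) * (ε ^ d + (L * ‖x - w‖) ^ d)) := by
          gcongr; exact add_pow_le hε (by positivity) d
        _ ≤ c₂ ^ d * (2 ^ d * (ε + L ^ d * (c₁ * B * ε))) := by
          rw [mul_pow]
          gcongr
          · norm_num
          · omega
          · exact pow_le_of_le_one hε hε1 hd.ne'
        _ = _ := by ring
    calc ‖x - y‖ ^ d ^ (N + 1) ≤ (‖x - w‖ + ‖w - y‖) ^ d ^ (N + 1) := by
          gcongr; exact norm_sub_le_norm_sub_add_norm_sub _ _ _
      _ ≤ 2 ^ (d ^ (N + 1) - 1) * (‖x - w‖ ^ d ^ (N + 1) + ‖w - y‖ ^ d ^ (N + 1)) :=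
        add_pow_le (norm_nonneg _) (norm_nonneg _) _
      _ ≤ 2 ^ (d ^ (N + 1)) * ((c₁ * B) ^ d ^ N * ε +
            c₂ ^ d * (2 ^ d * (1 + L ^ d * (c₁ * B))) * ε) := by
          gcongr
          · norm_num
          · omega
      _ = _ := by ring

theorem sq_dist_add_sq_dist_le_of_nearest {E : Type*} [NormedAddCommGroup E]
    [InnerProductSpace ℝ E] {K : Set E} (hK : Convex ℝ K) {u v y : E} (hv : v ∈ K)
    (hmin : ∀ w ∈ K, dist u v ≤ dist u w) (hy : y ∈ K) :
    dist v y ^ 2 + dist u v ^ 2 ≤ dist u y ^ 2 := by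
  have : Nonempty K := ⟨⟨v, hv⟩⟩
  have hinf : ‖u - v‖ = ⨅ w : K, ‖u - w‖ := by
    refine le_antisymm (le_ciInf fun w => ?_) ?_
    · simpa [dist_eq_norm] using hmin w w.2
    · exact ciInf_le (f := fun w : K => ‖u - w‖) ⟨0, by rintro _ ⟨w, rfl⟩; positivity⟩ ⟨v, hv⟩
  have h1 := (norm_eq_iInf_iff_real_inner_le_zero hK hv).1 hinf y hy
  have h2 : u - y = (u - v) - (y - v) := by abel
  rw [dist_comm v y, dist_eq_norm, dist_eq_norm, dist_eq_norm, h2, norm_sub_sq_real (u - v)]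
  linarith

/-- Under a Hölder regularity condition of exponent `1 / τ`, the cyclic projections converge at a
speed controlled by their distances `e k` to the intersection, which decrease along each cycle. -/
theorem cyclic_projection_tendsto_of_regularity {E : Type*} [NormedAddCommGroup E]
    [InnerProductSpace ℝ E] [ProperSpace E] {m : ℕ} (hm : 0 < m) (C : Fin m → Set E)
    (hclosed : ∀ i, IsClosed (C i)) (hconv : ∀ i, Convex ℝ (C i)) (hne : (⋂ i, C i).Nonempty)
    (x : ℕ → E) (hx : ∀ k : ℕ, x (k + 1) ∈ C ⟨k % m, Nat.mod_lt k hm⟩ ∧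
      ∀ y ∈ C ⟨k % m, Nat.mod_lt k hm⟩, dist (x k) (x (k + 1)) ≤ dist (x k) y)
    (τ : ℕ) (hreg : ∀ R > (0 : ℝ), ∃ c > (0 : ℝ), ∀ u, ‖u‖ ≤ R → ∀ ε, 0 ≤ ε →
      (∀ i, ∃ z ∈ C i, ‖z‖ ≤ R ∧ dist u z ≤ ε) → infDist u (⋂ i, C i) ^ τ ≤ c * ε) :
    ∃ xinf ∈ ⋂ i, C i, Tendsto x atTop (nhds xinf) ∧ ∃ e : ℕ → ℝ, Antitone e ∧ (∀ k, 0 ≤ e k) ∧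
      (∀ k, ‖x k - xinf‖ ≤ 2 * e k) ∧
      ∃ c > (0 : ℝ), ∀ l, e ((l + 1) * m) ^ 2 ≤ e (l * m) ^ 2 - c * (e (l * m) ^ 2) ^ τ := by
  set D := ⋂ i, C i
  have hDc : IsClosed D := isClosed_iInter hclosed
  have hDi : ∀ {y}, y ∈ D → ∀ i, y ∈ C i := fun hy i => mem_iInter.1 hy i
  have hfejer : ∀ k, ∀ y ∈ D, dist (x (k + 1)) y ^ 2 + dist (x k) (x (k + 1)) ^ 2 ≤
      dist (x k) y ^ 2 := fun k y hy =>
    sq_dist_add_sq_dist_le_of_nearest (hconv _) (hx k).1 (hx k).2 (hDi hy _)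
  have hanti : ∀ y ∈ D, Antitone fun k => dist (x k) y := fun y hy =>
    antitone_nat_of_succ_le fun k => by
      refine le_of_sq_le_sq ?_ dist_nonneg
      have := hfejer k y hy
      nlinarith [sq_nonneg (dist (x k) (x (k + 1)))]
  have hproj : ∀ k, ∃ y ∈ D, infDist (x k) D = dist (x k) y := fun k =>
    hDc.exists_infDist_eq_dist hne (x k)
  set e : ℕ → ℝ := fun k => infDist (x k) D with he
  have he0 : ∀ k, 0 ≤ e k := fun k => infDist_nonneg
  have hestep : ∀ k, e (k + 1) ^ 2 + dist (x k) (x (k + 1)) ^ 2 ≤ e k ^ 2 := fun k => by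
    obtain ⟨y, hy, hky⟩ := hproj k
    have h1 := hfejer k y hy
    have h2 : e (k + 1) ≤ dist (x (k + 1)) y := infDist_le_dist_of_mem hy
    have h3 : e (k + 1) ^ 2 ≤ dist (x (k + 1)) y ^ 2 := pow_le_pow_left₀ (he0 _) h2 2
    have h4 : e k = dist (x k) y := hky
    rw [h4]
    linarith
  have heanti : Antitone e := antitone_nat_of_succ_le fun k => by
    refine le_of_sq_le_sq ?_ (he0 k)
    nlinarith [hestep k, sq_nonneg (dist (x k) (x (k + 1)))]
  have hcauchy : ∀ N k, N ≤ k → dist (x k) (x N) ≤ 2 * e N := fun N k hk => by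
    obtain ⟨y, hy, hNy⟩ := hproj N
    have h1 : dist (x k) y ≤ dist (x N) y := hanti y hy hk
    have h2 : e N = dist (x N) y := hNy
    calc dist (x k) (x N) ≤ dist (x k) y + dist (x N) y := dist_triangle_right _ _ _
      _ ≤ 2 * e N := by rw [h2]; linarith
  have htele : ∀ k t, e (k + t) ^ 2 +
      ∑ s ∈ Finset.range t, dist (x (k + s)) (x (k + s + 1)) ^ 2 ≤ e k ^ 2 := fun k t => by
    induction t with
    | zero => simp
    | succ t ih =>
      rw [Finset.sum_range_succ]
      have := hestep (k + t)
      rw [← add_assoc k t 1]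
      linarith
  obtain ⟨y₀, hy₀⟩ := hne
  let R : ℝ := dist (x 0) y₀ + ‖y₀‖ + 1
  have hxR : ∀ k, ‖x k‖ ≤ R := fun k => by
    have h1 : dist (x k) y₀ ≤ dist (x 0) y₀ := hanti y₀ hy₀ (Nat.zero_le k)
    have h2 : ‖x k‖ ≤ ‖x k - y₀‖ + ‖y₀‖ := by
      simpa using norm_add_le (x k - y₀) y₀
    rw [← dist_eq_norm] at h2
    simp only [R]
    linarith
  obtain ⟨c, hc, hreg⟩ := hreg R (by positivity)
  have hcycle : ∀ l, e ((l + 1) * m) ^ 2 ≤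
      e (l * m) ^ 2 - (c ^ 2 * m)⁻¹ * (e (l * m) ^ 2) ^ τ := fun l => by
    set ε := ∑ s ∈ Finset.range m, dist (x (l * m + s)) (x (l * m + s + 1)) with hε
    have hbd := hreg (x (l * m)) (hxR _) ε (Finset.sum_nonneg fun _ _ => dist_nonneg)
      (fun i => by
        refine ⟨x (l * m + i + 1), ?_, hxR _, ?_⟩
        · have := (hx (l * m + i)).1
          have hi : (⟨(l * m + i) % m, Nat.mod_lt _ hm⟩ : Fin m) = i := by
            ext; simp [Nat.mod_eq_of_lt i.2]
          rwa [hi] at this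
        · have := dist_le_range_sum_dist (fun s => x (l * m + s)) (i + 1)
          simp only [add_zero, ← add_assoc] at this
          refine this.trans (Finset.sum_le_sum_of_subset_of_nonneg ?_ fun _ _ _ => dist_nonneg)
          exact Finset.range_subset_range.2 i.2)
    have hsq : ε ^ 2 ≤ m * ∑ s ∈ Finset.range m,
        dist (x (l * m + s)) (x (l * m + s + 1)) ^ 2 := by
      simpa using sq_sum_le_card_mul_sum_sq (s := Finset.range m)
        (f := fun s => dist (x (l * m + s)) (x (l * m + s + 1)))
    have h1 := htele (l * m) m
    rw [show l * m + m = (l + 1) * m by ring] at h1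
    have hm' : (0 : ℝ) < m := by exact_mod_cast hm
    have h2 : (e (l * m) ^ 2) ^ τ ≤ c ^ 2 * m * ∑ s ∈ Finset.range m,
        dist (x (l * m + s)) (x (l * m + s + 1)) ^ 2 := by
      calc (e (l * m) ^ 2) ^ τ = (e (l * m) ^ τ) ^ 2 := by rw [← pow_mul, ← pow_mul, mul_comm τ]
        _ ≤ (c * ε) ^ 2 := pow_le_pow_left₀ (pow_nonneg (he0 _) _) hbd 2
        _ = c ^ 2 * ε ^ 2 := mul_pow _ _ _
        _ ≤ c ^ 2 * (m * _) := by gcongr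
        _ = _ := by ring
    have h3 : (c ^ 2 * m)⁻¹ * (e (l * m) ^ 2) ^ τ ≤ ∑ s ∈ Finset.range m,
        dist (x (l * m + s)) (x (l * m + s + 1)) ^ 2 := by
      rwa [inv_mul_le_iff₀ (by positivity)]
    linarith
  have hm' : (0 : ℝ) < m := by exact_mod_cast hm
  have hc' : 0 < (c ^ 2 * m)⁻¹ := by positivity
  have hsum : ∀ l : ℕ, l * ((c ^ 2 * m)⁻¹ * (e (l * m) ^ 2) ^ τ) ≤ e 0 ^ 2 - e (l * m) ^ 2 := by
    intro l
    induction l with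
    | zero => simp
    | succ l ih =>
      have h1 : e ((l + 1) * m) ≤ e (l * m) := heanti (by gcongr; omega)
      have h2 : (c ^ 2 * m)⁻¹ * (e ((l + 1) * m) ^ 2) ^ τ ≤
          (c ^ 2 * m)⁻¹ * (e (l * m) ^ 2) ^ τ := by
        have := he0 ((l + 1) * m)
        gcongr
      have h3 := mul_le_mul_of_nonneg_left h2 (by positivity : (0 : ℝ) ≤ (l : ℝ) + 1)
      have h4 := hcycle l
      push_cast
      linarith
  have hsmall : ∀ η > (0 : ℝ), ∃ N, e N < η := by
    intro η hη
    by_contra! hle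
    obtain ⟨l, hl⟩ := exists_nat_gt (e 0 ^ 2 / ((c ^ 2 * m)⁻¹ * (η ^ 2) ^ τ))
    rw [div_lt_iff₀ (by positivity)] at hl
    have h1 : (l : ℝ) * ((c ^ 2 * m)⁻¹ * (η ^ 2) ^ τ) ≤
        l * ((c ^ 2 * m)⁻¹ * (e (l * m) ^ 2) ^ τ) := by
      have := hle (l * m)
      gcongr
    nlinarith [hsum l, sq_nonneg (e (l * m))]
  have hcs : CauchySeq x := Metric.cauchySeq_iff'.2 fun η hη => by
    obtain ⟨N, hN⟩ := hsmall (η / 2) (by positivity)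
    exact ⟨N, fun k hk => (hcauchy N k hk).trans_lt (by linarith)⟩
  obtain ⟨xinf, hlim⟩ := cauchySeq_tendsto_of_complete hcs
  have hrate : ∀ k, dist (x k) xinf ≤ 2 * e k := fun k => by
    refine le_of_tendsto (tendsto_const_nhds.dist hlim) ?_
    filter_upwards [eventually_ge_atTop k] with j hj
    rw [dist_comm]
    exact hcauchy k j hj
  refine ⟨xinf, ?_, hlim, e, heanti, he0, fun k => by rw [← dist_eq_norm]; exact hrate k,
    _, hc', hcycle⟩
  rw [hDc.mem_iff_infDist_zero ⟨y₀, hy₀⟩]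
  refine le_antisymm (le_of_forall_pos_le_add fun η hη => ?_) infDist_nonneg
  obtain ⟨N, hN⟩ := hsmall (η / 3) (by positivity)
  have h1 : infDist xinf D ≤ infDist (x N) D + dist xinf (x N) := infDist_le_infDist_add_dist
  have h2 := hrate N
  rw [dist_comm] at h2
  have h3 : infDist (x N) D = e N := rfl
  linarith

theorem pow_mul_le_one_of_le_sub_mul_pow {δ : ℕ → ℝ} {c : ℝ} {p : ℕ} (hp : 0 < p) (hc : 0 < c)
    (hδ : ∀ l, 0 ≤ δ l) (hrec : ∀ l, δ (l + 1) ≤ δ l - c * δ l ^ (p + 1)) (l : ℕ) :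
    δ l ^ p * (c * l) ≤ 1 := by
  induction l with
  | zero => simp
  | succ l ih =>
    have hu0 : 0 ≤ c * δ l ^ p := mul_nonneg hc.le (pow_nonneg (hδ l) _)
    rcases (hδ (l + 1)).eq_or_lt with h0 | h0
    · rw [← h0, zero_pow hp.ne']; simp
    have hmul : δ (l + 1) ≤ δ l * (1 - c * δ l ^ p) := by
      have := hrec l
      rw [pow_succ] at this
      linarith
    have hu1 : 0 ≤ 1 - c * δ l ^ p := by
      by_contra! hneg
      have := mul_nonpos_of_nonneg_of_nonpos (hδ l) hneg.le
      linarith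
    have h1 : δ (l + 1) ^ p ≤ δ l ^ p * (1 - c * δ l ^ p) := by
      calc δ (l + 1) ^ p ≤ (δ l * (1 - c * δ l ^ p)) ^ p := by gcongr
        _ = δ l ^ p * (1 - c * δ l ^ p) ^ p := mul_pow _ _ _
        _ ≤ _ := by
          have := hδ l
          gcongr
          exact pow_le_of_le_one hu1 (by linarith) hp.ne'
    push_cast
    calc δ (l + 1) ^ p * (c * (l + 1)) ≤ δ l ^ p * (1 - c * δ l ^ p) * (c * (l + 1)) := by gcongr
      _ = (1 - c * δ l ^ p) * (δ l ^ p * (c * l) + c * δ l ^ p) := by ring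
      _ ≤ (1 - c * δ l ^ p) * (1 + c * δ l ^ p) := by gcongr
      _ ≤ 1 := by nlinarith [sq_nonneg (c * δ l ^ p)]

theorem exists_rpow_rate {e : ℕ → ℝ} (he : Antitone e) (he0 : ∀ k, 0 ≤ e k) {m p : ℕ}
    (hm : 0 < m) (hp : 0 < p) {c : ℝ} (hc : 0 < c)
    (hrec : ∀ l, e ((l + 1) * m) ^ 2 ≤ e (l * m) ^ 2 - c * (e (l * m) ^ 2) ^ (p + 1)) {ρ : ℝ}
    (hρ : ρ ≤ 1 / (2 * p)) :
    ∃ M > (0 : ℝ), ∀ k : ℕ, 1 ≤ k → e k ≤ M * (k : ℝ) ^ (-ρ) := by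
  have hdec := pow_mul_le_one_of_le_sub_mul_pow (δ := fun l => e (l * m) ^ 2) hp hc
    (fun l => sq_nonneg _) hrec
  set A : ℝ := m / c + m * e 0 ^ (2 * p) with hA
  have hA0 : 0 ≤ A := by have := he0 0; positivity
  have hbound : ∀ k : ℕ, e k ^ (2 * p) * k ≤ A := by
    intro k
    have h1 : e k ≤ e (k / m * m) := he (Nat.div_mul_le_self k m)
    have h2 : (k : ℝ) ≤ (k / m : ℕ) * m + m := by
      have := Nat.div_add_mod' k m
      have := Nat.mod_lt k hm
      exact_mod_cast (by omega : k ≤ k / m * m + m)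
    have h3 := hdec (k / m)
    simp only [← pow_mul] at h3
    have h4 : e (k / m * m) ≤ e 0 := he (Nat.zero_le _)
    have h5 : e (k / m * m) ^ (2 * p) * (k / m : ℕ) ≤ 1 / c := by
      rw [le_div_iff₀ hc]; linarith
    have hk0 := he0 k
    have hk1 := he0 (k / m * m)
    calc e k ^ (2 * p) * k ≤ e (k / m * m) ^ (2 * p) * ((k / m : ℕ) * m + m) := by gcongr
      _ = m * (e (k / m * m) ^ (2 * p) * (k / m : ℕ)) + m * e (k / m * m) ^ (2 * p) := by ring
      _ ≤ m * (1 / c) + m * e 0 ^ (2 * p) := by gcongr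
      _ = A := by rw [hA]; ring
  refine ⟨A ^ (1 / (2 * p) : ℝ) + 1, by positivity, fun k hk => ?_⟩
  have hk' : (1 : ℝ) ≤ k := by exact_mod_cast hk
  have hk0 : (0 : ℝ) < k := by linarith
  have h1 : e k ^ (2 * p) ≤ A / k := (le_div_iff₀ hk0).2 (hbound k)
  calc e k = (e k ^ (2 * p)) ^ (1 / (2 * p) : ℝ) := by
        have := Real.pow_rpow_inv_natCast (he0 k) (n := 2 * p) (by omega)
        rw [one_div]
        push_cast at this
        exact this.symm
    _ ≤ (A / k) ^ (1 / (2 * p) : ℝ) := by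
        have := he0 k
        gcongr
    _ = A ^ (1 / (2 * p) : ℝ) * (k : ℝ) ^ (-(1 / (2 * p) : ℝ)) := by
        rw [Real.div_rpow hA0 hk0.le, Real.rpow_neg hk0.le, div_eq_mul_inv]
    _ ≤ (A ^ (1 / (2 * p) : ℝ) + 1) * (k : ℝ) ^ (-ρ) := by
        gcongr
        linarith

theorem exists_geometric_rate {e : ℕ → ℝ} (he : Antitone e) (he0 : ∀ k, 0 ≤ e k) {m : ℕ}
    (hm : 0 < m) {c : ℝ} (hc : 0 < c)
    (hrec : ∀ l, e ((l + 1) * m) ^ 2 ≤ e (l * m) ^ 2 - c * e (l * m) ^ 2) :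
    ∃ r ∈ Ioo (0 : ℝ) 1, ∃ M > (0 : ℝ), ∀ k : ℕ, e k ≤ M * r ^ k := by
  set q : ℝ := 1 - min c (1 / 2) with hq
  have hq0 : 0 < q := by have := min_le_right c (1 / 2); linarith
  have hq1 : q < 1 := by
    have : 0 < min c (1 / 2) := lt_min hc (by norm_num)
    linarith
  have hm' : (0 : ℝ) < m := by exact_mod_cast hm
  set r : ℝ := q ^ ((2 * m : ℕ) : ℝ)⁻¹ with hr
  have hr0 : 0 < r := Real.rpow_pos_of_pos hq0 _
  have hr1 : r < 1 := Real.rpow_lt_one hq0.le hq1 (by push_cast; positivity)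
  have hrq : (r ^ m) ^ 2 = q := by
    rw [← pow_mul, mul_comm m 2, hr]
    exact Real.rpow_inv_natCast_pow hq0.le (by omega)
  have hdec : ∀ l : ℕ, e (l * m) ≤ (r ^ m) ^ l * e 0 := by
    intro l
    induction l with
    | zero => simp
    | succ l ih =>
      have h1 : e ((l + 1) * m) ≤ r ^ m * e (l * m) := by
        refine le_of_sq_le_sq ?_ (mul_nonneg (by positivity) (he0 _))
        rw [mul_pow, hrq]
        have h2 : min c (1 / 2) * e (l * m) ^ 2 ≤ c * e (l * m) ^ 2 := by
          gcongr; exact min_le_left _ _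
        have h3 := hrec l
        rw [hq]
        linarith
      calc _ ≤ r ^ m * e (l * m) := h1
        _ ≤ r ^ m * ((r ^ m) ^ l * e 0) := by gcongr
        _ = _ := by ring
  refine ⟨r, ⟨hr0, hr1⟩, e 0 / r ^ m + 1, by have := he0 0; positivity, fun k => ?_⟩
  have h1 : e k ≤ e (k / m * m) := he (Nat.div_mul_le_self k m)
  have h2 : r ^ (m * (k / m)) * r ^ m ≤ r ^ k := by
    rw [← pow_add]
    refine pow_le_pow_of_le_one hr0.le hr1.le ?_
    have := Nat.div_add_mod k m
    have := Nat.mod_lt k hm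
    omega
  have h0 := he0 0
  calc e k ≤ (r ^ m) ^ (k / m) * e 0 := h1.trans (hdec _)
    _ = e 0 / r ^ m * (r ^ (m * (k / m)) * r ^ m) := by rw [← pow_mul]; field_simp
    _ ≤ e 0 / r ^ m * r ^ k := by gcongr
    _ ≤ _ := by gcongr; linarith

theorem polynomialOnLines_of_mvPolynomial {n d : ℕ} {p : MvPolynomial (Fin n) ℝ}
    (hp : p.totalDegree ≤ d) {f : EuclideanSpace ℝ (Fin n) → ℝ}
    (hf : ∀ x, f x = MvPolynomial.eval (fun t => x t) p) : PolynomialOnLines d f := fun x v => by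
  refine ⟨MvPolynomial.aeval
    (fun i => Polynomial.C (x i) + Polynomial.X * Polynomial.C (v i)) p, ?_, fun t => ?_⟩
  · refine (MvPolynomial.aeval_natDegree_le p hp _ (n := 1) fun i => ?_).trans (by simp)
    compute_degree
  · rw [hf, ← Polynomial.coe_evalRingHom, MvPolynomial.aeval_def, MvPolynomial.hom_eval₂,
      MvPolynomial.eval, MvPolynomial.coe_eval₂Hom]
    congr 1
    · ext; simp
    · ext i
      simp only [PiLp.add_apply, PiLp.smul_apply, smul_eq_mul]
      simp
      exact mul_comm _ _

theorem cyclic_projection_exponent_le {n d : ℕ} (hn : 0 < n) (hd : 1 < d) :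
    1 / min ((2 * (d : ℝ) - 1) ^ n - 1)
      (2 * (Nat.choose (n - 1) ((n - 1) / 2) : ℝ) * (d : ℝ) ^ n - 2) ≤
      1 / (2 * ((d ^ n - 1 : ℕ) : ℝ)) := by
  have hd1 : (1 : ℝ) < d := by exact_mod_cast hd
  have hdn : 1 < d ^ n := Nat.one_lt_pow hn.ne' hd
  have hcast : ((d ^ n - 1 : ℕ) : ℝ) = (d : ℝ) ^ n - 1 := by
    rw [Nat.cast_sub hdn.le]; push_cast; ring
  have hdn' : (1 : ℝ) < (d : ℝ) ^ n := by exact_mod_cast hdn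
  rw [hcast]
  refine one_div_le_one_div_of_le (by linarith) (le_min ?_ ?_)
  · have h := add_pow_le (by linarith : (0 : ℝ) ≤ 2 * d - 1) zero_le_one n
    rw [sub_add_cancel, mul_pow, one_pow] at h
    obtain ⟨k, rfl⟩ := Nat.exists_eq_succ_of_ne_zero hn.ne'
    simp only [Nat.succ_eq_add_one, add_tsub_cancel_right] at h ⊢
    rw [pow_succ (2 : ℝ) k, mul_assoc] at h
    have := le_of_mul_le_mul_left h (by positivity)
    linarith
  · have h : 1 ≤ Nat.choose (n - 1) ((n - 1) / 2) := Nat.choose_pos (Nat.div_le_self _ _)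
    have h' : (1 : ℝ) ≤ (Nat.choose (n - 1) ((n - 1) / 2) : ℝ) := by exact_mod_cast h
    nlinarith

/-- Estimate of the convergence rate of the cyclic projection algorithm applied to
finitely many basic semi-algebraic convex sets (Theorem 4.4). -/
theorem cyclic_projection_rate_basic_semialgebraic
    (n m d : ℕ) (hn : 0 < n) (hm : 0 < m) (hd : 0 < d)
    (γ : Fin m → ℕ) (hγ : ∀ i, 0 < γ i)
    (g : (i : Fin m) → Fin (γ i) → EuclideanSpace ℝ (Fin n) → ℝ)
    (hpoly : ∀ i j, ∃ p : MvPolynomial (Fin n) ℝ, p.totalDegree ≤ d ∧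
      ∀ x : EuclideanSpace ℝ (Fin n), g i j x = MvPolynomial.eval (fun t => x t) p)
    (hconv : ∀ i j, ConvexOn ℝ Set.univ (g i j))
    (C : Fin m → Set (EuclideanSpace ℝ (Fin n)))
    (hC : ∀ i, C i = {x | ∀ j, g i j x ≤ 0})
    (hne : (⋂ i, C i).Nonempty)
    -- the sequence of cyclic projections: `x (k+1)` is the nearest point of
    -- `C (k % m)` to `x k`
    (x : ℕ → EuclideanSpace ℝ (Fin n))
    (hx : ∀ k : ℕ, x (k + 1) ∈ C ⟨k % m, Nat.mod_lt k hm⟩ ∧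
      ∀ y ∈ C ⟨k % m, Nat.mod_lt k hm⟩, dist (x k) (x (k + 1)) ≤ dist (x k) y)
    (ρ : ℝ)
    (hρ : ρ = 1 / min ((2 * (d : ℝ) - 1) ^ n - 1)
                      (2 * (Nat.choose (n - 1) ((n - 1) / 2) : ℝ) * (d : ℝ) ^ n - 2)) :
    ∃ xinf ∈ ⋂ i, C i, Tendsto x atTop (nhds xinf) ∧
      ∃ M > (0 : ℝ), ∃ r₀ ∈ Set.Ioo (0 : ℝ) 1, ∀ k : ℕ, 1 ≤ k →
        (1 < d → ‖x k - xinf‖ ≤ M * (k : ℝ) ^ (-ρ)) ∧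
        (d = 1 → ‖x k - xinf‖ ≤ M * r₀ ^ k) := by
  have hG : ∀ i j, PolynomialOnLines d (g i j) := fun i j => by
    obtain ⟨p, hp, he⟩ := hpoly i j
    exact polynomialOnLines_of_mvPolynomial hp he
  have hclosed : ∀ i, IsClosed (C i) := fun i => by
    rw [hC i, ofPred_forall]
    exact isClosed_iInter fun j =>
      isClosed_le (hconv i j).locallyLipschitz.continuous continuous_const
  have hCconv : ∀ i, Convex ℝ (C i) := fun i => by
    rw [hC i, ofPred_forall]
    exact convex_iInter fun j => by simpa using (hconv i j).convex_le 0
  have hreg : ∀ R > (0 : ℝ), ∃ c > (0 : ℝ), ∀ u, ‖u‖ ≤ R → ∀ ε, 0 ≤ ε →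
      (∀ i, ∃ z ∈ C i, ‖z‖ ≤ R ∧ dist u z ≤ ε) → infDist u (⋂ i, C i) ^ (d ^ n) ≤ c * ε := by
    intro R hR
    obtain ⟨y₀, hy₀⟩ := hne
    have hy₀C : ∀ i j, g i j y₀ ≤ 0 := fun i j => by
      have := mem_iInter.1 hy₀ i
      rw [hC i] at this
      exact this j
    obtain ⟨L, hL, hLip⟩ := exists_lipschitz_bound_on_ball
      (g := fun j : (i : Fin m) × Fin (γ i) => g j.1 j.2) (fun j => hconv j.1 j.2) R
    obtain ⟨c, hc, hEB⟩ := exists_holder_error_bound hd n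
      (g := fun (j : (i : Fin m) × Fin (γ i)) w => g j.1 j.2 (y₀ + w)) (by simp)
      (fun j => by simpa [Function.comp_def] using (hconv j.1 j.2).translate_right y₀)
      (fun j w v => by simpa [add_assoc] using hG j.1 j.2 (y₀ + w) v)
      (fun j => by simpa using hy₀C j.1 j.2) (R + ‖y₀‖) (by positivity)
    refine ⟨c * L, by positivity, fun u hu ε hε hz => ?_⟩
    obtain ⟨y, hy, huy⟩ := hEB (u - y₀) ((norm_sub_le _ _).trans (by linarith)) (L * ε)
      (by positivity) (fun j => by
        obtain ⟨z, hzC, hzR, hzε⟩ := hz j.1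
        rw [hC] at hzC
        have h1 := hLip j z u hzR hu
        have h2 := hzC j.2
        have h3 : L * ‖z - u‖ ≤ L * ε := by
          rw [← dist_eq_norm, dist_comm]; gcongr
        simp only [add_sub_cancel]
        linarith)
    have hmem : y₀ + y ∈ ⋂ i, C i := mem_iInter.2 fun i => by
      rw [hC i]
      exact fun j => hy ⟨i, j⟩
    have h1 := infDist_le_dist_of_mem (x := u) hmem
    rw [dist_eq_norm, ← sub_sub] at h1
    calc infDist u (⋂ i, C i) ^ (d ^ n) ≤ ‖u - y₀ - y‖ ^ (d ^ n) :=
          pow_le_pow_left₀ infDist_nonneg h1 _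
      _ ≤ c * (L * ε) := huy
      _ = c * L * ε := by ring
  obtain ⟨xinf, hinf, hlim, e, he, he0, hxe, c, hc, hrec⟩ :=
    cyclic_projection_tendsto_of_regularity hm C hclosed hCconv hne x hx (d ^ n) hreg
  refine ⟨xinf, hinf, hlim, ?_⟩
  rcases (Nat.succ_le_of_lt hd).eq_or_lt with h1 | h1
  · have hd1 : d = 1 := h1.symm
    obtain ⟨r, hr, M, hM, hrate⟩ := exists_geometric_rate he he0 hm hc
      (by simpa [hd1] using hrec)
    refine ⟨2 * M, by positivity, r, hr, fun k _ => ⟨fun h => by omega, fun _ => ?_⟩⟩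
    linarith [hxe k, hrate k]
  · have hdn : 1 < d ^ n := Nat.one_lt_pow hn.ne' h1
    obtain ⟨M, hM, hrate⟩ := exists_rpow_rate he he0 hm (p := d ^ n - 1) (by omega) hc
      (by simpa only [Nat.sub_add_cancel hdn.le] using hrec)
      (hρ.trans_le (cyclic_projection_exponent_le hn h1))
    refine ⟨2 * M, by positivity, 1 / 2, by norm_num, fun k hk => ⟨fun _ => ?_, fun h => ?_⟩⟩
    · linarith [hxe k, hrate k hk]
    · omega
end
end
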